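/- arXiv:2209.00560 — 7 statements merged into one kernel-verified Lean document; each statement's English description precedes it below -/
import Mathlib

section
/- Let F be a free group of rank n ≥ 2, let Δ be a decomposition of F with pieces P and constant R, let λ : P → ℝ be a bounded alternating function, and let φ = φ_{λ,Δ} be the associated Δ-decomposable quasi-morphism. Let k₁, k₂ ≥ 1 and let ω₁ : F^{k₁} → ℝ and ω₂ : F^{k₂} → ℝ be bounded cocycles (δω₁ = 0 and δω₂ = 0). Then there exist cochains β₁ : F^{k₁+1} → ℝ, β₂ : F^{k₂+1} → ℝ and γ : F^{k₁+k₂} → ℝ such that δβ₁ = ω₁ ∪ δφ, δβ₂ = δφ ∪ ω₂, δγ = (−1)^{k₁} ω₁ ∪ β₂ − β₁ ∪ ω₂, and such that β₁ is bounded on aligned tuples B^{k₁+1}, β₂ is bounded on aligned tuples B^{k₂+1}, and γ is bounded on aligned tuples B^{k₁+k₂}. (This is the content of Theorem 1: the Massey triple product ⟨α₁, [δφ], α₂⟩ in bounded cohomology of F is trivial.) -/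
open Finset

noncomputable section

/-- The space of inhomogeneous `k`-cochains on a group `G` with trivial real coefficients:
functions `G^k → ℝ`. -/
abbrev Cochain (G : Type*) (k : ℕ) := (Fin k → G) → ℝ

/-- The cup product of inhomogeneous cochains:
`(a ∪ b)(g₁,…,g_{k+l}) = a(g₁,…,g_k) · b(g_{k+1},…,g_{k+l})`. -/
def cup {G : Type*} {k l : ℕ} (a : Cochain G k) (b : Cochain G l) : Cochain G (k + l) :=
  fun g => a (fun i => g (Fin.castAdd l i)) * b (fun i => g (Fin.natAdd k i))

/-- The inhomogeneous coboundary
`(δφ)(g₁,…,g_{k+1}) = φ(g₂,…,g_{k+1}) + Σ_{i=1}^{k} (−1)^i φ(g₁,…,g_i g_{i+1},…,g_{k+1})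
  + (−1)^{k+1} φ(g₁,…,g_k)`. -/
def cobo {G : Type*} [Group G] {k : ℕ} (a : Cochain G k) : Cochain G (k + 1) :=
  fun g =>
    a (fun i => g i.succ)
      + ∑ i : Fin k, (-1 : ℝ) ^ ((i : ℕ) + 1) *
          a (fun j => if (j : ℕ) < (i : ℕ) then g (Fin.castSucc j)
              else if (j : ℕ) = (i : ℕ) then g (Fin.castSucc j) * g j.succ
              else g j.succ)
      + (-1 : ℝ) ^ (k + 1) * a (fun i => g (Fin.castSucc i))

/-- Transport of a cochain along an equality of degrees. -/
def copyC {G : Type*} {k l : ℕ} (h : k = l) (a : Cochain G k) : Cochain G l :=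
  fun g => a fun i => g (Fin.cast h i)

/-- A cochain is bounded if it has finite sup norm. -/
def IsBoundedCochain {G : Type*} {k : ℕ} (a : Cochain G k) : Prop :=
  ∃ C, ∀ g, |a g| ≤ C

/-- The sup norm `‖a‖_∞` of a cochain. -/
def supNorm {G : Type*} {k : ℕ} (a : Cochain G k) : ℝ := ⨆ g, |a g|

variable {α : Type*} [DecidableEq α]

/-- The product `g * h` in a free group is reduced: `|gh| = |g| + |h|`. -/
def ReducedProd (g h : FreeGroup α) : Prop :=
  (g * h).norm = g.norm + h.norm

/-- The aligned tuples `B^k`: all entries are nontrivial and each product of consecutive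
entries is reduced. -/
def Aligned {k : ℕ} (g : Fin k → FreeGroup α) : Prop :=
  (∀ i, g i ≠ 1) ∧ ∀ i j : Fin k, (j : ℕ) = (i : ℕ) + 1 → ReducedProd (g i) (g j)

/-- A cochain on a free group is bounded on aligned tuples. -/
def BoundedOnAligned {k : ℕ} (a : Cochain (FreeGroup α) k) : Prop :=
  ∃ C, ∀ g, Aligned g → |a g| ≤ C

/-- A decomposition of the free group on `α`, with pieces `P` and constant `R`, in the sense
of Heuer: a map `Δ` assigning to every group element a finite sequence of pieces satisfying
(i) `g` is the reduced product of its pieces; (ii) compatibility with inverses;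
(iii) every contiguous subword of a decomposition is a decomposition;
(iv) the thick part of every geodesic triangle consists of at most `R` pieces on each side. -/
structure Decomposition (α : Type*) [DecidableEq α] where
  P : Set (FreeGroup α)
  R : ℕ
  R_pos : 0 < R
  symm : ∀ p ∈ P, p⁻¹ ∈ P
  one_notMem : (1 : FreeGroup α) ∉ P
  Δ : FreeGroup α → List (FreeGroup α)
  piece_mem : ∀ g : FreeGroup α, ∀ p ∈ Δ g, p ∈ P
  prod_eq : ∀ g : FreeGroup α, (Δ g).prod = g
  norm_eq : ∀ g : FreeGroup α, g.norm = ((Δ g).map FreeGroup.norm).sum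
  inv_eq : ∀ g : FreeGroup α, Δ (g⁻¹) = ((Δ g).reverse.map fun p => p⁻¹)
  infix_eq : ∀ (g : FreeGroup α) (l₁ l₂ l₃ : List (FreeGroup α)),
    Δ g = l₁ ++ l₂ ++ l₃ → Δ l₂.prod = l₂
  triangle : ∀ g h : FreeGroup α, ∃ c₁ c₂ c₃ r₁ r₂ r₃ : FreeGroup α,
    Δ g = Δ (c₁⁻¹) ++ Δ r₁ ++ Δ c₂ ∧
    Δ h = Δ (c₂⁻¹) ++ Δ r₂ ++ Δ c₃ ∧
    Δ ((g * h)⁻¹) = Δ (c₃⁻¹) ++ Δ r₃ ++ Δ c₁ ∧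
    (Δ r₁).length ≤ R ∧ (Δ r₂).length ≤ R ∧ (Δ r₃).length ≤ R

/-- `λ` is alternating on the pieces: `λ(p⁻¹) = −λ(p)`. -/
def IsAlternatingOnPieces (D : Decomposition α) (lam : FreeGroup α → ℝ) : Prop :=
  ∀ p ∈ D.P, lam p⁻¹ = -lam p

/-- `λ` is bounded on the pieces. -/
def BoundedOnPieces (D : Decomposition α) (lam : FreeGroup α → ℝ) : Prop :=
  ∃ C, ∀ p ∈ D.P, |lam p| ≤ C

/-- The `Δ`-decomposable quasi-morphism `φ_{λ,Δ}(g) = Σ_j λ(g^{(j)})`. -/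
def qm (D : Decomposition α) (lam : FreeGroup α → ℝ) (g : FreeGroup α) : ℝ :=
  ((D.Δ g).map lam).sum

/-- `φ_{λ,Δ}` viewed as a `1`-cochain. -/
def qmC (D : Decomposition α) (lam : FreeGroup α → ℝ) : Cochain (FreeGroup α) 1 :=
  fun g => qm D lam (g 0)

/-- `z^<_{j+1}(g)`: the product of the first `j` pieces of `g` (`j` is 0-indexed). -/
def zlt (D : Decomposition α) (g : FreeGroup α) (j : ℕ) : FreeGroup α :=
  ((D.Δ g).take j).prod

/-- `z^>_{j+1}(g)`: the product of the pieces of `g` after the `(j+1)`-st (`j` is 0-indexed). -/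
def zgt (D : Decomposition α) (g : FreeGroup α) (j : ℕ) : FreeGroup α :=
  ((D.Δ g).drop (j + 1)).prod

/-- `g^{(j+1)}`: the `(j+1)`-st piece of `g` (`j` is 0-indexed). -/
def piece (D : Decomposition α) (g : FreeGroup α) (j : ℕ) : FreeGroup α :=
  (D.Δ g).getD j 1

/-- `η₁(g₁,…,g_{k₁}) = Σ_{j=1}^{|Δ(g_{k₁})|} ω₁(g₁,…,g_{k₁−1}, z^<_j(g_{k₁}))·φ(g_{k₁}^{(j)})`. -/
def eta1 {m₁ : ℕ} (D : Decomposition α) (lam : FreeGroup α → ℝ)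
    (ω₁ : Cochain (FreeGroup α) (m₁ + 1)) : Cochain (FreeGroup α) (m₁ + 1) :=
  fun g => ∑ j ∈ Finset.range (D.Δ (g (Fin.last m₁))).length,
    ω₁ (Function.update g (Fin.last m₁) (zlt D (g (Fin.last m₁)) j)) *
      qm D lam (piece D (g (Fin.last m₁)) j)

/-- `η₂(h₁,…,h_{k₂}) = Σ_{j=1}^{|Δ(h₁)|} φ(h₁^{(j)})·ω₂(z^>_j(h₁), h₂,…,h_{k₂})`. -/
def eta2 {m₂ : ℕ} (D : Decomposition α) (lam : FreeGroup α → ℝ)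
    (ω₂ : Cochain (FreeGroup α) (m₂ + 1)) : Cochain (FreeGroup α) (m₂ + 1) :=
  fun h => ∑ j ∈ Finset.range (D.Δ (h 0)).length,
    qm D lam (piece D (h 0) j) * ω₂ (Function.update h 0 (zgt D (h 0) j))

/-- `η(g₁,…,g_{k₁−1}, e, h₂,…,h_{k₂})
  = Σ_{j=1}^{|Δ(e)|} ω₁(g₁,…,g_{k₁−1}, z^<_j(e))·φ(e^{(j)})·ω₂(z^>_j(e), h₂,…,h_{k₂})`,
where `e` sits in position `k₁` of the `(k₁+k₂−1)`-tuple. -/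
def etaM {m₁ m₂ : ℕ} (D : Decomposition α) (lam : FreeGroup α → ℝ)
    (ω₁ : Cochain (FreeGroup α) (m₁ + 1)) (ω₂ : Cochain (FreeGroup α) (m₂ + 1)) :
    Cochain (FreeGroup α) (m₁ + m₂ + 1) :=
  fun x =>
    ∑ j ∈ Finset.range (D.Δ (x ⟨m₁, by omega⟩)).length,
      ω₁ (Fin.snoc (fun i : Fin m₁ => x (Fin.castLE (by omega) i))
            (zlt D (x ⟨m₁, by omega⟩) j)) *
        qm D lam (piece D (x ⟨m₁, by omega⟩) j) *
        ω₂ (Fin.cons (zgt D (x ⟨m₁, by omega⟩) j)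
            (fun i : Fin m₂ => x ⟨m₁ + 1 + (i : ℕ), by have := i.isLt; omega⟩))


namespace MasseyAux

section nat
variable {G : Type*} [Group G]

def dN (i : ℕ) (g : ℕ → G) : ℕ → G := fun j =>
  if j + 1 < i then g j else if j + 1 = i then g j * g (j + 1) else g (j + 1)

def sh (k : ℕ) (g : ℕ → G) : ℕ → G := fun j => g (k + j)

def deltaN (k : ℕ) (A : (ℕ → G) → ℝ) : (ℕ → G) → ℝ := fun g =>
  ∑ i ∈ Finset.range (k + 2), (-1 : ℝ) ^ i * A (dN i g)

def Loc (k : ℕ) (A : (ℕ → G) → ℝ) : Prop :=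
  ∀ g g' : ℕ → G, (∀ i < k, g i = g' i) → A g = A g'

def cupN (k : ℕ) (A B : (ℕ → G) → ℝ) : (ℕ → G) → ℝ := fun g => A g * B (sh k g)

def lift {k : ℕ} (a : Cochain G k) : (ℕ → G) → ℝ := fun g => a fun i => g i

def extN {k : ℕ} (g : Fin k → G) : ℕ → G := fun i => if h : i < k then g ⟨i, h⟩ else 1

def res (k : ℕ) (A : (ℕ → G) → ℝ) : Cochain G k := fun g => A (extN g)

lemma extN_fin {k : ℕ} (g : Fin k → G) : (fun i : Fin k => extN g i) = g := by
  funext i; simp [extN]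

lemma lift_extN {k : ℕ} (a : Cochain G k) (g : Fin k → G) : lift a (extN g) = a g := by
  simp only [lift, extN_fin]

lemma lift_inj {k : ℕ} {a b : Cochain G k} (h : lift a = lift b) : a = b := by
  funext g; rw [← lift_extN a, ← lift_extN b, h]

lemma lift_res {k : ℕ} {A : (ℕ → G) → ℝ} (hA : Loc k A) : lift (res k A) = A := by
  funext g
  apply hA
  intro i hi
  simp [extN, hi]

lemma loc_lift {k : ℕ} (a : Cochain G k) : Loc k (lift a) := by
  intro g g' h
  simp only [lift]
  congr 1
  funext i
  exact h i i.2

lemma lift_cobo {k : ℕ} (a : Cochain G k) : lift (cobo a) = deltaN k (lift a) := by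
  funext g
  simp only [lift, cobo, deltaN]
  rw [Finset.sum_range_succ, Finset.sum_range_succ']
  rw [add_comm (∑ i ∈ Finset.range k, _)]
  congr 1
  · congr 1
    · simp [dN]
    · rw [Finset.sum_range]
      refine Finset.sum_congr rfl fun i _ => ?_
      congr 2
      funext j
      simp [dN]
  · congr 2
    funext j
    have := j.2
    simp only [dN, Fin.val_castSucc]
    rw [if_pos (by omega)]

lemma lift_cup {k l : ℕ} (a : Cochain G k) (b : Cochain G l) :
    lift (cup a b) = cupN k (lift a) (lift b) := by
  funext g
  simp [lift, cup, cupN, sh]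

lemma lift_copyC {k l : ℕ} (h : k = l) (a : Cochain G k) : lift (copyC h a) = lift a := by
  funext g
  simp [lift, copyC]

lemma loc_cupN {k l : ℕ} {A B : (ℕ → G) → ℝ} (hA : Loc k A) (hB : Loc l B) :
    Loc (k + l) (cupN k A B) := by
  intro g g' h
  simp only [cupN]
  rw [hA g g' (fun i hi => h i (by omega)), hB (sh k g) (sh k g') (fun i hi => h _ (by omega))]

lemma loc_deltaN {k : ℕ} {A : (ℕ → G) → ℝ} (hA : Loc k A) : Loc (k + 1) (deltaN k A) := by
  intro g g' h
  simp only [deltaN]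
  refine Finset.sum_congr rfl fun i _ => ?_
  congr 1
  apply hA
  intro j hj
  simp only [dN]
  rw [h j (by omega), h (j + 1) (by omega)]

lemma dN_dN {i j : ℕ} (h : j ≤ i) (g : ℕ → G) : dN j (dN (i + 1) g) = dN i (dN j g) := by
  funext t
  simp only [dN]
  split_ifs <;> first | rfl | (exfalso; omega) | simp only [mul_assoc]

lemma deltaN_deltaN (k : ℕ) (A : (ℕ → G) → ℝ) (g : ℕ → G) :
    deltaN (k + 1) (deltaN k A) g = 0 := by
  simp only [deltaN, Finset.mul_sum]
  rw [← Finset.sum_product']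
  refine Finset.sum_involution
    (fun x _ => if x.2 < x.1 then (x.2, x.1 - 1) else (x.2 + 1, x.1)) ?_ ?_ ?_ ?_
  · rintro ⟨i, j⟩ hx
    simp only
    split_ifs with h
    · obtain ⟨i, rfl⟩ : ∃ t, i = t + 1 := ⟨i - 1, by omega⟩
      rw [dN_dN (by omega)]
      simp only [Nat.add_sub_cancel]
      ring
    · rw [dN_dN (by omega)]
      ring
  · rintro ⟨i, j⟩ hx _
    simp only
    split_ifs with h <;> simp only [ne_eq, Prod.mk.injEq] <;> omega
  · rintro ⟨i, j⟩ hx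
    simp only [Finset.mem_product, Finset.mem_range] at hx ⊢
    split_ifs with h <;> simp only <;> omega
  · rintro ⟨i, j⟩ hx
    simp only
    by_cases h : j < i
    · rw [if_pos h, if_neg (by simp only; omega)]
      simp only [Prod.mk.injEq, and_true]; omega
    · rw [if_neg h, if_pos (by simp only; omega)]
      simp

lemma deltaN_cupN {k l : ℕ} {A B : (ℕ → G) → ℝ} (hA : Loc k A) (g : ℕ → G) :
    deltaN (k + l) (cupN k A B) g =
      deltaN k A g * B (sh (k + 1) g) + (-1) ^ k * (A g * deltaN l B (sh k g)) := by
  simp only [deltaN, cupN]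
  have e1 : k + l + 2 = (k + 1) + (l + 1) := by ring
  rw [e1, Finset.sum_range_add, Finset.sum_range_succ (n := k + 1),
    Finset.sum_range_succ' (n := l + 1), add_mul, Finset.sum_mul, mul_add, mul_add, Finset.mul_sum,
    Finset.mul_sum]
  have h1 : ∀ i ∈ Finset.range (k + 1), (-1 : ℝ) ^ i * (A (dN i g) * B (sh k (dN i g)))
      = (-1) ^ i * A (dN i g) * B (sh (k + 1) g) := by
    intro i hi
    rw [Finset.mem_range] at hi
    have : sh k (dN i g) = sh (k + 1) g := by
      funext t
      simp only [sh, dN]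
      rw [if_neg (by omega), if_neg (by omega)]
      congr 1; ring
    rw [this]; ring
  have h2 : ∀ i ∈ Finset.range (l + 1),
      (-1 : ℝ) ^ (k + 1 + i) * (A (dN (k + 1 + i) g) * B (sh k (dN (k + 1 + i) g)))
      = (-1) ^ k * (A g * ((-1) ^ (i + 1) * B (dN (i + 1) (sh k g)))) := by
    intro i hi
    have e : sh k (dN (k + 1 + i) g) = dN (i + 1) (sh k g) := by
      funext t
      simp only [sh, dN]
      split_ifs <;> first | rfl | (exfalso; omega)
    have e' : A (dN (k + 1 + i) g) = A g := by
      apply hA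
      intro t ht
      simp only [dN]
      rw [if_pos (by omega)]
    rw [e, e']; ring
  have h3 : A (dN (k + 1) g) = A g := by
    apply hA
    intro t ht
    simp only [dN]
    rw [if_pos (by omega)]
  have h4 : dN 0 (sh k g) = sh (k + 1) g := by
    funext t
    simp only [sh, dN]
    rw [if_neg (by omega), if_neg (by omega)]
    congr 1; ring
  rw [Finset.sum_congr rfl h1, Finset.sum_congr rfl h2, h3, h4]
  ring

lemma deltaN_add (k : ℕ) (A B : (ℕ → G) → ℝ) : deltaN k (A + B) = deltaN k A + deltaN k B := by
  funext g
  simp only [deltaN, Pi.add_apply, mul_add, Finset.sum_add_distrib]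

lemma deltaN_smul (k : ℕ) (c : ℝ) (A : (ℕ → G) → ℝ) : deltaN k (c • A) = c • deltaN k A := by
  funext g
  simp only [deltaN, Pi.smul_apply, smul_eq_mul, Finset.mul_sum]
  refine Finset.sum_congr rfl fun i _ => by ring

/-- cocycle relation, solved for the faces not touching the last entry -/
lemma left_faces {m : ℕ} {w : (ℕ → G) → ℝ} (hw : Loc (m + 1) w) (hc : ∀ g, deltaN (m + 1) w g = 0)
    (g : ℕ → G) (x : G) :
    ∑ i ∈ Finset.range (m + 1), (-1 : ℝ) ^ i * w (Function.update (dN i g) m x) =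
      (-1) ^ m * (w (Function.update g m (g m * x)) - w g) := by
  have h := hc (Function.update g (m + 1) x)
  simp only [deltaN] at h
  rw [Finset.sum_range_succ, Finset.sum_range_succ] at h
  have h1 : ∀ i ∈ Finset.range (m + 1), (-1 : ℝ) ^ i * w (dN i (Function.update g (m + 1) x))
      = (-1 : ℝ) ^ i * w (Function.update (dN i g) m x) := by
    intro i hi
    rw [Finset.mem_range] at hi
    congr 2
    funext t
    simp only [dN, Function.update_apply]
    split_ifs <;> first | rfl | (exfalso; omega)
  have h2 : w (dN (m + 1) (Function.update g (m + 1) x)) = w (Function.update g m (g m * x)) := by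
    apply hw
    intro t ht
    simp only [dN, Function.update_apply]
    split_ifs <;> first | rfl | (exfalso; omega) | skip
    have : t = m := by omega
    rw [this]
  have h3 : w (dN (m + 1 + 1) (Function.update g (m + 1) x)) = w g := by
    apply hw
    intro t ht
    simp only [dN, Function.update_apply]
    split_ifs <;> first | rfl | (exfalso; omega)
  rw [Finset.sum_congr rfl h1, h2, h3] at h
  simp only [pow_succ] at h
  linarith

lemma right_faces {m : ℕ} {w : (ℕ → G) → ℝ} (hc : ∀ g, deltaN (m + 1) w g = 0)
    (h : ℕ → G) (y : G) :
    ∑ i ∈ Finset.range (m + 1), (-1 : ℝ) ^ i * w (Function.update (dN (i + 2) h) 0 y) =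
      w (Function.update (sh 1 h) 0 (y * h 1)) - w (sh 1 h) := by
  have H := hc (Function.update h 0 y)
  simp only [deltaN] at H
  rw [Finset.sum_range_succ', Finset.sum_range_succ'] at H
  have h1 : ∀ i ∈ Finset.range (m + 1),
      (-1 : ℝ) ^ (i + 1 + 1) * w (dN (i + 1 + 1) (Function.update h 0 y))
      = (-1 : ℝ) ^ i * w (Function.update (dN (i + 2) h) 0 y) := by
    intro i hi
    have : dN (i + 1 + 1) (Function.update h 0 y) = Function.update (dN (i + 2) h) 0 y := by
      funext t
      simp only [dN, Function.update_apply]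
      split_ifs <;> first | rfl | (exfalso; omega)
    rw [this]; ring
  have h2 : dN (0 + 1) (Function.update h 0 y) = Function.update (sh 1 h) 0 (y * h 1) := by
    funext t
    simp only [dN, sh, Function.update_apply]
    split_ifs <;> first | rfl | (exfalso; omega) | simp_all [add_comm]
  have h3 : dN 0 (Function.update h 0 y) = sh 1 h := by
    funext t
    simp only [dN, sh, Function.update_apply]
    split_ifs <;> first | rfl | (exfalso; omega) | simp [add_comm]
  rw [Finset.sum_congr rfl h1, h2, h3] at H
  norm_num at H
  linarith

end nat

section lists
variable {G : Type*} [Group G]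

def T (lam : G → ℝ) : List G → (G → G → ℝ) → ℝ
  | [], _ => 0
  | p :: l, w => w 1 l.prod * lam p + T lam l (fun x y => w (p * x) y)

lemma T_append (lam : G → ℝ) (l₁ l₂ : List G) (w : G → G → ℝ) :
    T lam (l₁ ++ l₂) w = T lam l₁ (fun x y => w x (y * l₂.prod)) +
      T lam l₂ (fun x y => w (l₁.prod * x) y) := by
  induction l₁ generalizing w with
  | nil => simp [T]
  | cons p l ih => simp only [List.cons_append, T, ih, List.prod_append, List.prod_cons, mul_assoc,
      add_assoc]

lemma T_bound (lam : G → ℝ) {C L : ℝ} (l : List G) (hl : ∀ p ∈ l, |lam p| ≤ L)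
    (w : G → G → ℝ) (hw : ∀ x y, |w x y| ≤ C) : |T lam l w| ≤ l.length * (C * L) := by
  induction l generalizing w with
  | nil => simp [T]
  | cons p l ih =>
    simp only [T, List.length_cons]
    have h1 := ih (fun q hq => hl q (by simp [hq])) (fun x y => w (p * x) y) (fun x y => hw _ _)
    have h2 : |w 1 l.prod * lam p| ≤ C * L := by
      rw [abs_mul]
      exact mul_le_mul (hw _ _) (hl p (by simp)) (abs_nonneg _) ((abs_nonneg _).trans (hw 1 1))
    have h3 := abs_add_le (w 1 l.prod * lam p) (T lam l (fun x y => w (p * x) y))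
    push_cast
    linarith

lemma T_sum (lam : G → ℝ) (l : List G) (s : Finset ℕ) (c : ℕ → ℝ) (w : ℕ → G → G → ℝ) :
    ∑ i ∈ s, c i * T lam l (w i) = T lam l (fun x y => ∑ i ∈ s, c i * w i x y) := by
  induction l generalizing w with
  | nil => simp [T]
  | cons p l ih =>
    simp only [T, mul_add, Finset.sum_add_distrib, ih, Finset.sum_mul, mul_assoc]

lemma T_smul_sub (lam : G → ℝ) (l : List G) (c : ℝ) (w w' : G → G → ℝ) :
    T lam l (fun x y => c * (w x y - w' x y)) = c * (T lam l w - T lam l w') := by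
  induction l generalizing w w' with
  | nil => simp [T]
  | cons p l ih =>
    simp only [T]
    rw [ih (fun x y => w (p * x) y) (fun x y => w' (p * x) y)]
    ring

lemma T_mul_left (lam : G → ℝ) (l : List G) (c : ℝ) (w : G → G → ℝ) :
    T lam l (fun x y => c * w x y) = c * T lam l w := by
  simpa [show T lam l (fun _ _ => 0) = 0 from by
    have := T_smul_sub lam l 0 w w; simpa using this] using T_smul_sub lam l c w (fun _ _ => 0)

lemma T_const (lam : G → ℝ) (l : List G) (c : ℝ) :
    T lam l (fun _ _ => c) = c * (l.map lam).sum := by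
  induction l with
  | nil => simp [T]
  | cons p l ih => simp only [T, ih, List.map_cons, List.sum_cons]; ring

end lists

section dec
variable {α : Type*} [DecidableEq α]

lemma Delta_one (D : Decomposition α) : D.Δ 1 = [] := by
  rw [List.eq_nil_iff_forall_not_mem]
  intro p hp
  have h := D.norm_eq 1
  rw [FreeGroup.norm_one] at h
  have h2 : p.norm ≤ ((D.Δ 1).map FreeGroup.norm).sum :=
    List.single_le_sum (by simp) _ (List.mem_map_of_mem hp)
  have : p = 1 := FreeGroup.norm_eq_zero.1 (by omega)
  exact D.one_notMem (this ▸ D.piece_mem _ _ hp)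

def S (D : Decomposition α) (lam : FreeGroup α → ℝ) (e : FreeGroup α)
    (w : FreeGroup α → FreeGroup α → ℝ) : ℝ := T lam (D.Δ e) w

lemma S_key (D : Decomposition α) (lam : FreeGroup α → ℝ) {L C : ℝ}
    (hL0 : 0 ≤ L) (hL : ∀ p ∈ D.P, |lam p| ≤ L) (e f : FreeGroup α) (hef : ReducedProd e f)
    (w : FreeGroup α → FreeGroup α → ℝ) (hw : ∀ x y, |w x y| ≤ C) :
    |S D lam (e * f) w - S D lam e (fun x y => w x (y * f)) - S D lam f (fun x y => w (e * x) y)|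
      ≤ 3 * (D.R * (C * L)) := by
  obtain ⟨c₁, c₂, c₃, r₁, r₂, r₃, h1, h2, h3, b1, b2, b3⟩ := D.triangle e f
  have n1 : e.norm = c₁⁻¹.norm + r₁.norm + c₂.norm := by
    rw [D.norm_eq e, h1, D.norm_eq c₁⁻¹, D.norm_eq r₁, D.norm_eq c₂]
    simp [add_assoc]
  have n2 : f.norm = c₂⁻¹.norm + r₂.norm + c₃.norm := by
    rw [D.norm_eq f, h2, D.norm_eq c₂⁻¹, D.norm_eq r₂, D.norm_eq c₃]
    simp [add_assoc]
  have p1 : e = c₁⁻¹ * r₁ * c₂ := by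
    conv_lhs => rw [← D.prod_eq e, h1]
    simp [D.prod_eq, mul_assoc]
  have p2 : f = c₂⁻¹ * r₂ * c₃ := by
    conv_lhs => rw [← D.prod_eq f, h2]
    simp [D.prod_eq, mul_assoc]
  have hc : c₂ = 1 := by
    have q : e * f = (c₁⁻¹ * r₁) * (r₂ * c₃) := by rw [p1, p2]; group
    have q1 := FreeGroup.norm_mul_le (c₁⁻¹ * r₁) (r₂ * c₃)
    have q2 := FreeGroup.norm_mul_le c₁⁻¹ r₁
    have q3 := FreeGroup.norm_mul_le r₂ c₃
    have q4 : (e * f).norm = e.norm + f.norm := hef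
    rw [q] at q4
    exact FreeGroup.norm_eq_zero.1 (by omega)
  subst hc
  have h3' : D.Δ (e * f) = D.Δ c₁⁻¹ ++ D.Δ r₃⁻¹ ++ D.Δ c₃ := by
    have h := D.inv_eq (e * f)⁻¹
    rw [inv_inv, h3] at h
    rw [h]
    have := D.inv_eq c₃⁻¹
    rw [inv_inv] at this
    rw [D.inv_eq c₁, D.inv_eq r₃, this]
    simp
  have p3 : e * f = c₁⁻¹ * r₃⁻¹ * c₃ := by
    conv_lhs => rw [← D.prod_eq (e * f), h3']
    simp [D.prod_eq, mul_assoc]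
  rw [inv_one, Delta_one] at h2
  rw [Delta_one] at h1
  simp only [List.nil_append, List.append_nil] at h1 h2
  simp only [mul_one, inv_one, one_mul] at p1 p2
  have b3' : (D.Δ r₃⁻¹).length ≤ D.R := by rw [D.inv_eq]; simpa using b3
  have hmid : ∀ (r : FreeGroup α) (v : FreeGroup α → FreeGroup α → ℝ), (D.Δ r).length ≤ D.R →
      (∀ x y, |v x y| ≤ C) → |T lam (D.Δ r) v| ≤ D.R * (C * L) := by
    intro r v hr hv
    have hC0 : 0 ≤ C := (abs_nonneg _).trans (hv 1 1)
    refine (T_bound lam _ (fun p hp => hL p (D.piece_mem _ _ hp)) v hv).trans ?_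
    gcongr
  have k1 := hmid r₃⁻¹ (fun x y => w (c₁⁻¹ * x) (y * c₃)) b3' (fun x y => hw _ _)
  have k2 := hmid r₁ (fun x y => w (c₁⁻¹ * x) (y * f)) b1 (fun x y => hw _ _)
  have k3 := hmid r₂ (fun x y => w (e * x) (y * c₃)) b2 (fun x y => hw _ _)
  have z1 : r₁ * f = r₃⁻¹ * c₃ := by
    rw [p1, mul_assoc, mul_assoc] at p3
    exact mul_left_cancel p3
  have z2 : e * r₂ = c₁⁻¹ * r₃⁻¹ := by
    rw [p2, ← mul_assoc] at p3
    exact mul_right_cancel p3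
  have s1 : S D lam (e * f) w = T lam (D.Δ c₁⁻¹) (fun x y => w x (y * (r₃⁻¹ * c₃))) +
      T lam (D.Δ r₃⁻¹) (fun x y => w (c₁⁻¹ * x) (y * c₃)) +
      T lam (D.Δ c₃) (fun x y => w (c₁⁻¹ * r₃⁻¹ * x) y) := by
    rw [S, h3', T_append, T_append]
    simp only [List.prod_append, D.prod_eq, mul_assoc]
  have s2 : S D lam e (fun x y => w x (y * f)) =
      T lam (D.Δ c₁⁻¹) (fun x y => w x (y * (r₃⁻¹ * c₃))) +
      T lam (D.Δ r₁) (fun x y => w (c₁⁻¹ * x) (y * f)) := by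
    rw [S, h1, T_append]
    simp only [D.prod_eq, mul_assoc, z1]
  have s3 : S D lam f (fun x y => w (e * x) y) =
      T lam (D.Δ r₂) (fun x y => w (e * x) (y * c₃)) +
      T lam (D.Δ c₃) (fun x y => w (c₁⁻¹ * r₃⁻¹ * x) y) := by
    rw [S, h2, T_append]
    simp only [D.prod_eq, ← mul_assoc, z2]
  rw [s1, s2, s3]
  rw [abs_le] at k1 k2 k3 ⊢
  constructor <;> linarith [k1.1, k1.2, k2.1, k2.2, k3.1, k3.2]

section final
variable (D : Decomposition α) (lam : FreeGroup α → ℝ)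

def e1 (m : ℕ) (w : (ℕ → FreeGroup α) → ℝ) : (ℕ → FreeGroup α) → ℝ := fun g =>
  S D lam (g m) (fun x _ => w (Function.update g m x))

def e2 (w : (ℕ → FreeGroup α) → ℝ) : (ℕ → FreeGroup α) → ℝ := fun g =>
  S D lam (g 0) (fun _ y => w (Function.update g 0 y))

def eM (m : ℕ) (w v : (ℕ → FreeGroup α) → ℝ) : (ℕ → FreeGroup α) → ℝ := fun g =>
  S D lam (g m) (fun x y => w (Function.update g m x) * v (Function.update (sh m g) 0 y))

def ph : (ℕ → FreeGroup α) → ℝ := fun g => qm D lam (g 0)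

lemma loc_upd {m k : ℕ} {w : (ℕ → FreeGroup α) → ℝ} (hw : Loc k w) (g g' : ℕ → FreeGroup α)
    (h : ∀ i < k, i ≠ m → g i = g' i) (x : FreeGroup α) :
    w (Function.update g m x) = w (Function.update g' m x) := by
  apply hw
  intro i hi
  by_cases him : i = m
  · subst him; simp
  · simp [him, h i hi him]

lemma loc_e1 {m : ℕ} {w : (ℕ → FreeGroup α) → ℝ} (hw : Loc (m + 1) w) :
    Loc (m + 1) (e1 D lam m w) := by
  intro g g' h
  simp only [e1, h m (by omega), loc_upd hw g g' (fun i hi _ => h i hi)]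

lemma loc_e2 {m : ℕ} {w : (ℕ → FreeGroup α) → ℝ} (hw : Loc (m + 1) w) :
    Loc (m + 1) (e2 D lam w) := by
  intro g g' h
  simp only [e2, h 0 (by omega), loc_upd hw g g' (fun i hi _ => h i hi)]

lemma loc_eM {m₁ m₂ : ℕ} {w v : (ℕ → FreeGroup α) → ℝ} (hw : Loc (m₁ + 1) w)
    (hv : Loc (m₂ + 1) v) : Loc (m₁ + m₂ + 1) (eM D lam m₁ w v) := by
  intro g g' h
  simp only [eM, h m₁ (by omega), loc_upd hw g g' (fun i hi _ => h i (by omega)),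
    loc_upd hv (sh m₁ g) (sh m₁ g') (fun i hi _ => h _ (by omega))]

lemma delta_e1 {m : ℕ} {w : (ℕ → FreeGroup α) → ℝ} (hw : Loc (m + 1) w)
    (hc : ∀ g, deltaN (m + 1) w g = 0) (g : ℕ → FreeGroup α) :
    deltaN (m + 1) (e1 D lam m w) g = (-1) ^ (m + 1) * (w g * qm D lam (g (m + 1))
      + (S D lam (g m * g (m + 1)) (fun x _ => w (Function.update g m x))
        - S D lam (g m) (fun x _ => w (Function.update g m x))
        - S D lam (g (m + 1)) (fun x _ => w (Function.update g m (g m * x))))) := by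
  have a1 : ∀ i ∈ Finset.range (m + 1), (-1 : ℝ) ^ i * e1 D lam m w (dN i g) =
      (-1 : ℝ) ^ i * T lam (D.Δ (g (m + 1))) (fun x _ => w (Function.update (dN i g) m x)) := by
    intro i hi
    rw [Finset.mem_range] at hi
    have : dN i g m = g (m + 1) := by
      simp only [dN]; rw [if_neg (by omega), if_neg (by omega)]
    simp only [e1, S, this]
  have a2 : e1 D lam m w (dN (m + 1) g) =
      S D lam (g m * g (m + 1)) (fun x _ => w (Function.update g m x)) := by
    have : dN (m + 1) g m = g m * g (m + 1) := by simp [dN]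
    simp only [e1, this]
    congr 1; funext x _
    apply loc_upd hw
    intro i hi hm
    simp only [dN]; rw [if_pos (by omega)]
  have a3 : e1 D lam m w (dN (m + 1 + 1) g) =
      S D lam (g m) (fun x _ => w (Function.update g m x)) := by
    apply loc_e1 D lam hw
    intro i hi
    simp only [dN]; rw [if_pos (by omega)]
  rw [deltaN, Finset.sum_range_succ, Finset.sum_range_succ, Finset.sum_congr rfl a1, T_sum, a2, a3]
  simp only [left_faces hw hc]
  rw [T_smul_sub, T_const]
  simp only [S, qm]
  ring

lemma delta_e2 {m : ℕ} {w : (ℕ → FreeGroup α) → ℝ}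
    (hc : ∀ g, deltaN (m + 1) w g = 0) (g : ℕ → FreeGroup α) :
    deltaN (m + 1) (e2 D lam w) g = - (qm D lam (g 0) * w (sh 1 g))
      - (S D lam (g 0 * g 1) (fun _ y => w (Function.update (sh 1 g) 0 y))
        - S D lam (g 0) (fun _ y => w (Function.update (sh 1 g) 0 (y * g 1)))
        - S D lam (g 1) (fun _ y => w (Function.update (sh 1 g) 0 y))) := by
  have a1 : ∀ i ∈ Finset.range (m + 1), (-1 : ℝ) ^ (i + 1 + 1) * e2 D lam w (dN (i + 1 + 1) g) =
      (-1 : ℝ) ^ i * T lam (D.Δ (g 0)) (fun _ y => w (Function.update (dN (i + 2) g) 0 y)) := by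
    intro i hi
    have : dN (i + 1 + 1) g 0 = g 0 := by simp [dN]
    simp only [e2, S, this]
    ring
  have a2 : e2 D lam w (dN (0 + 1) g) =
      S D lam (g 0 * g 1) (fun _ y => w (Function.update (sh 1 g) 0 y)) := by
    have : dN (0 + 1) g 0 = g 0 * g 1 := by simp [dN]
    simp only [e2, this]
    congr 1; funext _ y
    congr 1; funext t
    simp only [dN, sh, Function.update_apply]
    split_ifs <;> first | rfl | (exfalso; omega) | simp [add_comm]
  have a3 : dN 0 g = sh 1 g := by
    funext t; simp [dN, sh, add_comm]
  have a4 : e2 D lam w (sh 1 g) =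
      S D lam (g 1) (fun _ y => w (Function.update (sh 1 g) 0 y)) := by
    simp [e2, sh]
  rw [deltaN, Finset.sum_range_succ', Finset.sum_range_succ', Finset.sum_congr rfl a1, T_sum, a2,
    a3, a4]
  simp only [right_faces hc]
  have := T_smul_sub lam (D.Δ (g 0)) 1 (fun _ y => w (Function.update (sh 1 g) 0 (y * g 1)))
    (fun _ _ => w (sh 1 g))
  simp only [one_mul] at this
  rw [this, T_const]
  simp only [S, qm]
  ring

lemma delta_eM {m₁ m₂ : ℕ} {w v : (ℕ → FreeGroup α) → ℝ} (hw : Loc (m₁ + 1) w)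
    (hc : ∀ g, deltaN (m₁ + 1) w g = 0)
    (hc' : ∀ g, deltaN (m₂ + 1) v g = 0) (g : ℕ → FreeGroup α) :
    deltaN (m₁ + m₂ + 1) (eM D lam m₁ w v) g = (-1) ^ (m₁ + 1) *
      (w g * e2 D lam v (sh (m₁ + 1) g) + e1 D lam m₁ w g * v (sh (m₁ + 1) g)
      + (S D lam (g m₁ * g (m₁ + 1)) (fun x y => w (Function.update g m₁ x) *
          v (Function.update (sh (m₁ + 1) g) 0 y))
        - S D lam (g m₁) (fun x y => w (Function.update g m₁ x) *
          v (Function.update (sh (m₁ + 1) g) 0 (y * g (m₁ + 1))))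
        - S D lam (g (m₁ + 1)) (fun x y => w (Function.update g m₁ (g m₁ * x)) *
          v (Function.update (sh (m₁ + 1) g) 0 y)))) := by
  have a1 : ∀ i ∈ Finset.range (m₁ + 1), (-1 : ℝ) ^ i * eM D lam m₁ w v (dN i g) =
      (-1 : ℝ) ^ i * T lam (D.Δ (g (m₁ + 1))) (fun x y => w (Function.update (dN i g) m₁ x) *
        v (Function.update (sh (m₁ + 1) g) 0 y)) := by
    intro i hi
    rw [Finset.mem_range] at hi
    have h1 : dN i g m₁ = g (m₁ + 1) := by
      simp only [dN]; rw [if_neg (by omega), if_neg (by omega)]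
    have h2 : sh m₁ (dN i g) = sh (m₁ + 1) g := by
      funext t
      simp only [sh, dN]
      rw [if_neg (by omega), if_neg (by omega)]
      congr 1; ring
    simp only [eM, S, h1, h2]
  have a2 : eM D lam m₁ w v (dN (m₁ + 1) g) =
      S D lam (g m₁ * g (m₁ + 1)) (fun x y => w (Function.update g m₁ x) *
          v (Function.update (sh (m₁ + 1) g) 0 y)) := by
    have : dN (m₁ + 1) g m₁ = g m₁ * g (m₁ + 1) := by simp [dN]
    simp only [eM, this]
    congr 1; funext x y
    congr 1
    · apply loc_upd hw
      intro i hi hm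
      simp only [dN]; rw [if_pos (by omega)]
    · congr 1; funext t
      by_cases ht : t = 0
      · subst ht; simp
      · simp only [Function.update_apply, if_neg ht, sh, dN]
        rw [if_neg (by omega), if_neg (by omega)]
        congr 1; ring
  have a3 : ∀ i ∈ Finset.range (m₂ + 1),
      (-1 : ℝ) ^ (m₁ + 2 + i) * eM D lam m₁ w v (dN (m₁ + 2 + i) g) =
      (-1 : ℝ) ^ m₁ * ((-1) ^ i * T lam (D.Δ (g m₁)) (fun x y => w (Function.update g m₁ x) *
        v (Function.update (dN (i + 2) (sh m₁ g)) 0 y))) := by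
    intro i hi
    have h1 : dN (m₁ + 2 + i) g m₁ = g m₁ := by
      simp only [dN]; rw [if_pos (by omega)]
    have h2 : sh m₁ (dN (m₁ + 2 + i) g) = dN (i + 2) (sh m₁ g) := by
      funext t
      simp only [sh, dN]
      split_ifs <;> first | rfl | (exfalso; omega)
    have h3 : ∀ x, w (Function.update (dN (m₁ + 2 + i) g) m₁ x) = w (Function.update g m₁ x) := by
      intro x
      apply loc_upd hw
      intro j hj hm
      simp only [dN]; rw [if_pos (by omega)]
    simp only [eM, S, h1, h2, h3]
    ring
  have en : m₁ + m₂ + 1 + 2 = m₁ + 2 + (m₂ + 1) := by ring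
  have h5 : sh 1 (sh m₁ g) = sh (m₁ + 1) g := by
    funext t; simp only [sh]; congr 1; ring
  have h6 : sh m₁ g 1 = g (m₁ + 1) := rfl
  rw [deltaN, en, Finset.sum_range_add, Finset.sum_range_succ, Finset.sum_congr rfl a1,
    Finset.sum_congr rfl a3, ← Finset.mul_sum, T_sum, T_sum, a2]
  have f1 : ∀ x y, ∑ i ∈ Finset.range (m₁ + 1), (-1 : ℝ) ^ i *
      (w (Function.update (dN i g) m₁ x) * v (Function.update (sh (m₁ + 1) g) 0 y)) =
      (-1) ^ m₁ * (w (Function.update g m₁ (g m₁ * x)) * v (Function.update (sh (m₁ + 1) g) 0 y)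
        - w g * v (Function.update (sh (m₁ + 1) g) 0 y)) := by
    intro x y
    simp only [← mul_assoc]
    rw [← Finset.sum_mul, left_faces hw hc]
    ring
  have f2 : ∀ x y, ∑ i ∈ Finset.range (m₂ + 1), (-1 : ℝ) ^ i *
      (w (Function.update g m₁ x) * v (Function.update (dN (i + 2) (sh m₁ g)) 0 y)) =
      1 * (w (Function.update g m₁ x) *
          v (Function.update (sh (m₁ + 1) g) 0 (y * g (m₁ + 1)))
        - v (sh (m₁ + 1) g) * w (Function.update g m₁ x)) := by
    intro x y
    simp only [mul_left_comm _ (w _)]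
    rw [← Finset.mul_sum, right_faces hc', h5, h6]
    ring
  simp only [f1, f2]
  rw [T_smul_sub, T_smul_sub, T_mul_left, T_mul_left]
  have h7 : sh (m₁ + 1) g 0 = g (m₁ + 1) := rfl
  simp only [S, e1, e2, h7]
  ring

lemma loc_ph : Loc 1 (ph D lam) := by
  intro g g' h
  simp only [ph, h 0 (by omega)]

lemma loc_add {k : ℕ} {A B : (ℕ → FreeGroup α) → ℝ} (hA : Loc k A) (hB : Loc k B) :
    Loc k (A + B) := by
  intro g g' h
  simp only [Pi.add_apply, hA g g' h, hB g g' h]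

lemma loc_smul {k : ℕ} {A : (ℕ → FreeGroup α) → ℝ} (c : ℝ) (hA : Loc k A) :
    Loc k (c • A) := by
  intro g g' h
  simp only [Pi.smul_apply, hA g g' h]

def b1 (m : ℕ) (w : (ℕ → FreeGroup α) → ℝ) : (ℕ → FreeGroup α) → ℝ :=
  (-1 : ℝ) ^ (m + 1) • cupN (m + 1) w (ph D lam) + (-1 : ℝ) • deltaN (m + 1) (e1 D lam m w)

def b2 (m : ℕ) (w : (ℕ → FreeGroup α) → ℝ) : (ℕ → FreeGroup α) → ℝ :=
  cupN 1 (ph D lam) w + deltaN (m + 1) (e2 D lam w)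

def gam (m₁ m₂ : ℕ) (w v : (ℕ → FreeGroup α) → ℝ) : (ℕ → FreeGroup α) → ℝ :=
  cupN (m₁ + 1) w (e2 D lam v) + cupN (m₁ + 1) (e1 D lam m₁ w) v
    + (-(-1 : ℝ) ^ (m₁ + 1)) • deltaN (m₁ + m₂ + 1) (eM D lam m₁ w v)

lemma reduced_ext {k : ℕ} {g : Fin k → FreeGroup α} (hg : Aligned g) (i : ℕ) (hi : i + 1 < k) :
    ReducedProd (extN g i) (extN g (i + 1)) := by
  have := hg.2 ⟨i, by omega⟩ ⟨i + 1, hi⟩ rfl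
  simpa [extN, hi, show i < k by omega] using this

end final
end dec
end MasseyAux

open MasseyAux in
/-- **Theorem 1 of the paper.** For a `Δ`-decomposable quasi-morphism `φ = φ_{λ,Δ}` on the
free group `F` of rank `n ≥ 2` and bounded cocycles `ω₁, ω₂` of degrees `k₁ = m₁+1 ≥ 1`
and `k₂ = m₂+1 ≥ 1`, there exist primitives `β₁` of `ω₁ ∪ δφ` and `β₂` of `δφ ∪ ω₂`, and a
primitive `γ` of `(−1)^{k₁} ω₁ ∪ β₂ − β₁ ∪ ω₂`, all bounded on aligned tuples; hence the
Massey triple product `⟨α₁, [δφ], α₂⟩` is trivial in bounded cohomology. -/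
theorem massey_triple_product_trivial
    (n : ℕ) (hn : 2 ≤ n) (D : Decomposition (Fin n)) (lam : FreeGroup (Fin n) → ℝ)
    (hAlt : IsAlternatingOnPieces D lam) (hBdd : BoundedOnPieces D lam)
    (m₁ m₂ : ℕ)
    (ω₁ : Cochain (FreeGroup (Fin n)) (m₁ + 1)) (ω₂ : Cochain (FreeGroup (Fin n)) (m₂ + 1))
    (hω₁ : IsBoundedCochain ω₁) (hω₂ : IsBoundedCochain ω₂)
    (hc₁ : cobo ω₁ = 0) (hc₂ : cobo ω₂ = 0) :
    ∃ (β₁ : Cochain (FreeGroup (Fin n)) (m₁ + 2))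
      (β₂ : Cochain (FreeGroup (Fin n)) (m₂ + 2))
      (γ : Cochain (FreeGroup (Fin n)) (m₁ + m₂ + 2)),
      cobo β₁ = cup ω₁ (cobo (qmC D lam)) ∧
      cobo β₂ = copyC (show 2 + (m₂ + 1) = m₂ + 2 + 1 by omega) (cup (cobo (qmC D lam)) ω₂) ∧
      cobo γ = copyC (show (m₁ + 1) + (m₂ + 2) = m₁ + m₂ + 2 + 1 by omega)
                  ((-1 : ℝ) ^ (m₁ + 1) • cup ω₁ β₂)
               - copyC (show (m₁ + 2) + (m₂ + 1) = m₁ + m₂ + 2 + 1 by omega) (cup β₁ ω₂) ∧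
      BoundedOnAligned β₁ ∧ BoundedOnAligned β₂ ∧ BoundedOnAligned γ := by
  obtain ⟨C₁, hC₁⟩ := hω₁
  obtain ⟨C₂, hC₂⟩ := hω₂
  obtain ⟨L', hL'⟩ := hBdd
  obtain ⟨L, hL0, hL⟩ : ∃ L : ℝ, 0 ≤ L ∧ ∀ p ∈ D.P, |lam p| ≤ L :=
    ⟨max L' 0, le_max_right _ _, fun p hp => (hL' p hp).trans (le_max_left _ _)⟩
  have hs : ∀ k : ℕ, ((-1 : ℝ) ^ k) * (-1) ^ k = 1 := fun k => by
    rw [← mul_pow]; norm_num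
  have hw : Loc (m₁ + 1) (lift ω₁) := loc_lift ω₁
  have hv : Loc (m₂ + 1) (lift ω₂) := loc_lift ω₂
  have hcw : ∀ g, deltaN (m₁ + 1) (lift ω₁) g = 0 := fun g => by
    rw [← lift_cobo, hc₁]; rfl
  have hcv : ∀ g, deltaN (m₂ + 1) (lift ω₂) g = 0 := fun g => by
    rw [← lift_cobo, hc₂]; rfl
  have bw : ∀ g, |lift ω₁ g| ≤ C₁ := fun g => hC₁ _
  have bv : ∀ g, |lift ω₂ g| ≤ C₂ := fun g => hC₂ _
  have hq : lift (qmC D lam) = ph D lam := rfl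
  have l1 : Loc (m₁ + 2) (b1 D lam m₁ (lift ω₁)) :=
    loc_add (loc_smul _ (loc_cupN hw (loc_ph D lam)))
      (loc_smul _ (loc_deltaN (loc_e1 D lam hw)))
  have l2 : Loc (m₂ + 2) (b2 D lam m₂ (lift ω₂)) := by
    refine loc_add ?_ (loc_deltaN (loc_e2 D lam hv))
    have := loc_cupN (loc_ph D lam) hv
    rwa [show 1 + (m₂ + 1) = m₂ + 2 by ring] at this
  have l3 : Loc (m₁ + m₂ + 2) (gam D lam m₁ m₂ (lift ω₁) (lift ω₂)) := by
    have e : m₁ + 1 + (m₂ + 1) = m₁ + m₂ + 2 := by ring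
    have t1 := loc_cupN hw (loc_e2 D lam hv)
    have t2 := loc_cupN (loc_e1 D lam hw) hv
    rw [e] at t1 t2
    exact loc_add (loc_add t1 t2) (loc_smul _ (loc_deltaN (loc_eM D lam hw hv)))
  refine ⟨res _ (b1 D lam m₁ (lift ω₁)), res _ (b2 D lam m₂ (lift ω₂)),
    res _ (gam D lam m₁ m₂ (lift ω₁) (lift ω₂)), ?_, ?_, ?_, ?_, ?_, ?_⟩
  · apply lift_inj
    rw [lift_cobo, lift_res l1, lift_cup, lift_cobo, hq]
    funext g
    have h := deltaN_cupN (l := 1) (B := ph D lam) hw g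
    have h' := deltaN_deltaN (m₁ + 1) (e1 D lam m₁ (lift ω₁)) g
    rw [hcw] at h
    rw [b1, deltaN_add, deltaN_smul, deltaN_smul]
    simp only [Pi.add_apply, Pi.smul_apply, smul_eq_mul, h', cupN] at h ⊢
    rw [h]
    linear_combination (lift ω₁ g * deltaN 1 (ph D lam) (sh (m₁ + 1) g)) * hs (m₁ + 1)
  · apply lift_inj
    rw [lift_cobo, lift_res l2, lift_copyC, lift_cup, lift_cobo, hq]
    funext g
    have h := deltaN_cupN (l := m₂ + 1) (B := lift ω₂) (loc_ph D lam) g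
    have h' := deltaN_deltaN (m₂ + 1) (e2 D lam (lift ω₂)) g
    rw [hcv, show 1 + (m₂ + 1) = m₂ + 2 by ring] at h
    rw [b2, deltaN_add]
    simp only [Pi.add_apply, h', cupN] at h ⊢
    rw [h]
    ring
  · apply lift_inj
    rw [lift_cobo, lift_res l3]
    have hsub : ∀ a b : Cochain (FreeGroup (Fin n)) (m₁ + m₂ + 2 + 1),
      lift (a - b) = lift a - lift b := fun _ _ => rfl
    have hsm : ∀ (c : ℝ) (a : Cochain (FreeGroup (Fin n)) (m₁ + 1 + (m₂ + 2))),
      lift (c • a) = c • lift a := fun _ _ => rfl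
    rw [hsub, lift_copyC, lift_copyC, hsm, lift_cup, lift_cup, lift_res l1, lift_res l2]
    funext g
    have t1 := deltaN_cupN (l := m₂ + 1) (B := e2 D lam (lift ω₂)) hw g
    have t2 := deltaN_cupN (l := m₂ + 1) (B := lift ω₂) (loc_e1 D lam hw) g
    have t3 := deltaN_deltaN (m₁ + m₂ + 1) (eM D lam m₁ (lift ω₁) (lift ω₂)) g
    rw [show m₁ + 1 + (m₂ + 1) = m₁ + m₂ + 2 by ring] at t1 t2
    rw [hcw] at t1
    rw [hcv] at t2
    rw [gam, deltaN_add, deltaN_add, deltaN_smul]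
    have s1 : sh 1 (sh (m₁ + 1) g) = sh (m₁ + 2) g := by
      funext t; simp only [sh]; congr 1; ring
    have s2 : ph D lam (sh (m₁ + 1) g) = qm D lam (g (m₁ + 1)) := rfl
    simp only [Pi.add_apply, Pi.smul_apply, Pi.sub_apply, smul_eq_mul, t1, t2, t3, b1, b2, cupN,
      s1, s2]
    ring
  · refine ⟨3 * (D.R * (C₁ * L)), fun g hg => ?_⟩
    have hr := reduced_ext hg m₁ (by omega)
    simp only [res]
    generalize extN g = G at hr
    have key := S_key D lam hL0 hL _ _ hr
      (fun x _ => lift ω₁ (Function.update G m₁ x)) (fun x y => bw _)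
    have d := delta_e1 D lam hw hcw G
    have s2 : ph D lam (sh (m₁ + 1) G) = qm D lam (G (m₁ + 1)) := rfl
    simp only [b1, Pi.add_apply, Pi.smul_apply, smul_eq_mul, cupN, d, s2]
    have hab : ∀ (k : ℕ) (a b : ℝ), |(-1 : ℝ) ^ k * a + -1 * ((-1) ^ k * (a + b))| = |b| := by
      intro k a b
      rw [show (-1 : ℝ) ^ k * a + -1 * ((-1) ^ k * (a + b)) = -((-1) ^ k * b) by ring, abs_neg,
        abs_mul, abs_pow, abs_neg, abs_one, one_pow, one_mul]
    rw [hab]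
    exact key
  · refine ⟨3 * (D.R * (C₂ * L)), fun g hg => ?_⟩
    have hr := reduced_ext hg 0 (by omega)
    simp only [res]
    generalize extN g = G at hr
    have key := S_key D lam hL0 hL _ _ hr
      (fun _ y => lift ω₂ (Function.update (sh 1 G) 0 y)) (fun x y => bv _)
    have d := delta_e2 D lam hcv G
    have s2 : ph D lam G = qm D lam (G 0) := rfl
    simp only [b2, Pi.add_apply, cupN, d, s2]
    rw [← abs_neg]
    refine le_of_eq_of_le ?_ key
    congr 1
    simp only [zero_add]
    ring
  · refine ⟨3 * (D.R * ((C₁ * C₂) * L)), fun g hg => ?_⟩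
    have hr := reduced_ext hg m₁ (by omega)
    simp only [res]
    generalize extN g = G at hr
    have key := S_key D lam hL0 hL _ _ hr
      (fun x y => lift ω₁ (Function.update G m₁ x) *
        lift ω₂ (Function.update (sh (m₁ + 1) G) 0 y)) (C := C₁ * C₂) (fun x y => by
          rw [abs_mul]
          exact mul_le_mul (bw _) (bv _) (abs_nonneg _) ((abs_nonneg _).trans (bw (fun _ => 1))))
    have d := delta_eM D lam hw hcw hcv G
    simp only [gam, Pi.add_apply, Pi.smul_apply, smul_eq_mul, cupN, d]
    rw [← mul_assoc, neg_mul, hs, ← abs_neg]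
    refine le_of_eq_of_le ?_ key
    congr 1
    ring
end
end

section
/- Let F be a free group of rank n ≥ 2, let Δ be a decomposition of F with pieces P and constant R, let λ : P → ℝ be a bounded alternating function and φ = φ_{λ,Δ}. Let k₁, k₂ ≥ 1 and let ω₁ : F^{k₁} → ℝ and ω₂ : F^{k₂} → ℝ be bounded cocycles, and let η₁, η₂, η be the associated cochains. Then the cochain ω₁ ∪ η₂ + η₁ ∪ ω₂ − (−1)^{k₁} δη is bounded on aligned tuples: for every (g₁,…,g_{k₁},h₁,…,h_{k₂}) ∈ B^{k₁+k₂} one has |(ω₁ ∪ η₂ + η₁ ∪ ω₂ − (−1)^{k₁} δη)(g₁,…,g_{k₁},h₁,…,h_{k₂})| ≤ 3R · ‖ω₁‖_∞ · ‖ω₂‖_∞ · sup_{p ∈ P} |λ(p)|. -/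
open Finset

noncomputable section

variable {α : Type*} [DecidableEq α]

namespace LeftoverAux

/-- Face map on sequences. -/
def dface {G : Type*} [Group G] (i : ℕ) (x : ℕ → G) : ℕ → G :=
  fun j => if j + 1 < i then x j else if j + 1 = i then x j * x (j + 1) else x (j + 1)

lemma cobo_eq {G : Type*} [Group G] {k : ℕ} (a : Cochain G k) (x : ℕ → G) :
    cobo a (fun i => x i) =
      ∑ i ∈ Finset.range (k + 2), (-1 : ℝ) ^ i * a (fun j => dface i x j) := by
  rw [Finset.sum_range_succ, Finset.sum_range_succ']
  unfold cobo
  rw [← Fin.sum_univ_eq_sum_range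
    (fun i => (-1 : ℝ) ^ (i + 1) * a (fun j => dface (i + 1) x j))]
  have h0 : a (fun i : Fin k => x (i.succ : Fin (k+1))) = a (fun j => dface 0 x j) := by
    congr 1
  have hl : a (fun i : Fin k => x (Fin.castSucc i : Fin (k+1))) =
      a (fun j => dface (k + 1) x j) := by
    congr 1; funext j
    have := j.isLt
    simp [dface]
  have hm : ∀ i : Fin k, a (fun j => if (j : ℕ) < (i : ℕ) then x (Fin.castSucc j : Fin (k+1))
              else if (j : ℕ) = (i : ℕ) then x (Fin.castSucc j : Fin (k+1)) * x (j.succ : Fin (k+1))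
              else x (j.succ : Fin (k+1))) = a (fun j => dface ((i : ℕ) + 1) x j) := by
    intro i
    congr 1; funext j
    simp [dface]
  rw [h0, hl, Finset.sum_congr rfl (fun i _ => by rw [hm i])]
  ring

/-- The basic sum. -/
def S {G : Type*} [Group G] (μ f k : G → ℝ) (a : G) (L : List G) (b : G) : ℝ :=
  ∑ j ∈ Finset.range L.length,
    f (a * (L.take j).prod) * μ (L.getD j 1) * k ((L.drop (j + 1)).prod * b)

lemma S_append {G : Type*} [Group G] (μ f k : G → ℝ) (a : G) (L M : List G) (b : G) :
    S μ f k a (L ++ M) b = S μ f k a L (M.prod * b) + S μ f k (a * L.prod) M b := by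
  unfold S
  rw [List.length_append, Finset.sum_range_add]
  congr 1
  · refine Finset.sum_congr rfl fun j hj => ?_
    have hj := Finset.mem_range.1 hj
    rw [List.take_append_of_le_length hj.le, List.drop_append_of_le_length hj,
      List.getD_append _ _ _ _ hj, List.prod_append, mul_assoc (List.prod _)]
  · refine Finset.sum_congr rfl fun j hj => ?_
    rw [List.getD_append_right _ _ _ _ (by omega), List.take_append, List.drop_append,
      List.take_of_length_le (by omega), List.drop_of_length_le (by omega)]
    simp [mul_assoc, add_assoc]

lemma S_bound {G : Type*} [Group G] (μ f k : G → ℝ) (A B C : ℝ)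
    (hf : ∀ z, |f z| ≤ A) (hk : ∀ z, |k z| ≤ B) (a : G) (L : List G) (b : G) (N : ℕ)
    (hN : L.length ≤ N)
    (hμ : ∀ p ∈ L, |μ p| ≤ C) (hC : 0 ≤ C) : |S μ f k a L b| ≤ N * (A * B * C) := by
  have hA : 0 ≤ A := (abs_nonneg _).trans (hf 1)
  have hB : 0 ≤ B := (abs_nonneg _).trans (hk 1)
  have : |S μ f k a L b| ≤ ∑ j ∈ Finset.range L.length, A * B * C := by
    refine (Finset.abs_sum_le_sum_abs _ _).trans (Finset.sum_le_sum fun j hj => ?_)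
    have hj := Finset.mem_range.1 hj
    rw [abs_mul, abs_mul]
    have h1 : |μ (L.getD j 1)| ≤ C := by
      apply hμ
      rw [List.getD_eq_getElem _ _ hj]
      exact List.getElem_mem hj
    calc _ ≤ A * C * B := by
          gcongr
          · exact hf _
          · exact hk _
      _ = _ := by ring
  refine this.trans ?_
  rw [Finset.sum_const, Finset.card_range, nsmul_eq_mul]
  gcongr

variable {α : Type*} [DecidableEq α]

lemma etaM_eq {m₁ m₂ : ℕ} (D : Decomposition α) (lam : FreeGroup α → ℝ)
    (ω₁ : Cochain (FreeGroup α) (m₁ + 1)) (ω₂ : Cochain (FreeGroup α) (m₂ + 1))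
    (x : ℕ → FreeGroup α) :
    etaM D lam ω₁ ω₂ (fun i => x i) =
      S (qm D lam) (fun z => ω₁ (Fin.snoc (α := fun _ => FreeGroup α) (fun i : Fin m₁ => x i) z))
        (fun z => ω₂ (Fin.cons (α := fun _ => FreeGroup α) z (fun i : Fin m₂ => x (m₁ + 1 + i))))
        1 (D.Δ (x m₁)) 1 := by
  simp [etaM, S, zlt, zgt, piece]

lemma eta1_eq {m₁ : ℕ} (D : Decomposition α) (lam : FreeGroup α → ℝ)
    (ω₁ : Cochain (FreeGroup α) (m₁ + 1)) 
    (x : ℕ → FreeGroup α) (c : ℝ) :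
    eta1 D lam ω₁ (fun i => x i) * c =
      S (qm D lam) (fun z => ω₁ (Fin.snoc (α := fun _ => FreeGroup α) (fun i : Fin m₁ => x i) z))
        (fun _ => c)
        1 (D.Δ (x m₁)) 1 := by
  have : ∀ z, Function.update (fun i : Fin (m₁+1) => x i) (Fin.last m₁) z =
      Fin.snoc (α := fun _ => FreeGroup α) (fun i : Fin m₁ => x i) z := by
    intro z
    funext j
    refine Fin.lastCases ?_ (fun j => ?_) j
    · simp
    · rw [Function.update_of_ne (Fin.castSucc_lt_last j).ne]; simp
  simp [eta1, S, zlt, piece, this, Finset.sum_mul]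

lemma eta2_eq {m₂ : ℕ} (D : Decomposition α) (lam : FreeGroup α → ℝ)
    (ω₂ : Cochain (FreeGroup α) (m₂ + 1)) 
    (x : ℕ → FreeGroup α) (c : ℝ) :
    c * eta2 D lam ω₂ (fun i => x i) =
      S (qm D lam) (fun _ => c)
        (fun z => ω₂ (Fin.cons (α := fun _ => FreeGroup α) z (fun i : Fin m₂ => x (i + 1))))
        1 (D.Δ (x 0)) 1 := by
  have : ∀ z, Function.update (fun i : Fin (m₂+1) => x i) 0 z =
      Fin.cons (α := fun _ => FreeGroup α) z (fun i : Fin m₂ => x (i + 1)) := by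
    intro z
    funext j
    refine Fin.cases ?_ (fun j => ?_) j
    · simp
    · rw [Function.update_of_ne (Fin.succ_ne_zero j)]; simp
  simp [eta2, S, zgt, piece, this, Finset.mul_sum, mul_assoc]

lemma cocycle1 {G : Type*} [Group G] {m₁ : ℕ} (ω₁ : Cochain G (m₁ + 1)) (hc : cobo ω₁ = 0)
    (x : ℕ → G) (z : G) :
    ∑ i ∈ Finset.range (m₁ + 1), (-1 : ℝ) ^ i *
        ω₁ (Fin.snoc (α := fun _ => G) (fun j : Fin m₁ => dface i x j) z) =
      (-1 : ℝ) ^ (m₁ + 1) * (ω₁ (fun i => x i) -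
        ω₁ (Fin.snoc (α := fun _ => G) (fun j : Fin m₁ => x j) (x m₁ * z))) := by
  have h := (cobo_eq ω₁ (fun j => if j ≤ m₁ then x j else z)).symm.trans (congrFun hc _)
  rw [Finset.sum_range_succ, Finset.sum_range_succ] at h
  have e1 : (fun j : Fin (m₁ + 1) => dface (m₁ + 1 + 1) (fun j => if j ≤ m₁ then x j else z) j)
      = fun i : Fin (m₁ + 1) => x i := by
    funext j
    have := j.isLt
    simp [dface, Nat.lt_succ_iff.1 this]
  have e2 : (fun j : Fin (m₁ + 1) => dface (m₁ + 1) (fun j => if j ≤ m₁ then x j else z) j)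
      = Fin.snoc (α := fun _ => G) (fun j : Fin m₁ => x j) (x m₁ * z) := by
    funext j
    refine Fin.lastCases ?_ (fun j => ?_) j
    · simp [dface]
    · have := j.isLt
      simp [dface, this.le]
  have e3 : ∀ i ∈ Finset.range (m₁ + 1),
      (-1 : ℝ) ^ i * ω₁ (fun j : Fin (m₁ + 1) => dface i (fun j => if j ≤ m₁ then x j else z) j)
      = (-1 : ℝ) ^ i * ω₁ (Fin.snoc (α := fun _ => G) (fun j : Fin m₁ => dface i x j) z) := by
    intro i hi
    have hi := Finset.mem_range.1 hi
    congr 2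
    funext j
    refine Fin.lastCases ?_ (fun j => ?_) j
    · simp [dface, show ¬ (m₁ + 1 < i) by omega, show ¬ (m₁ + 1 = i) by omega]
    · have := j.isLt
      simp [dface, this.le, Nat.succ_le_of_lt this]
  rw [e1, e2, Finset.sum_congr rfl e3] at h
  simp only [Pi.zero_apply] at h
  linear_combination h

lemma cocycle2 {G : Type*} [Group G] {m₁ m₂ : ℕ} (ω₂ : Cochain G (m₂ + 1)) (hc : cobo ω₂ = 0)
    (x : ℕ → G) (z : G) :
    ∑ l ∈ Finset.range (m₂ + 1), (-1 : ℝ) ^ l *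
        ω₂ (Fin.cons (α := fun _ => G) z
          (fun j : Fin m₂ => dface (m₁ + 2 + l) x (m₁ + 1 + j))) =
       ω₂ (Fin.cons (α := fun _ => G) (z * x (m₁ + 1)) (fun j : Fin m₂ => x (m₁ + 2 + j)))
        - ω₂ (fun i => x (m₁ + 1 + i)) := by
  have h := (cobo_eq ω₂ (fun j => if j = 0 then z else x (m₁ + j))).symm.trans (congrFun hc _)
  rw [Finset.sum_range_succ', Finset.sum_range_succ'] at h
  have e1 : (fun j : Fin (m₂ + 1) => dface 0 (fun j => if j = 0 then z else x (m₁ + j)) j)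
      = fun i : Fin (m₂ + 1) => x (m₁ + 1 + i) := by
    funext j
    simp [dface]
    congr 1; omega
  have e2 : (fun j : Fin (m₂ + 1) => dface (0 + 1) (fun j => if j = 0 then z else x (m₁ + j)) j)
      = Fin.cons (α := fun _ => G) (z * x (m₁ + 1)) (fun j : Fin m₂ => x (m₁ + 2 + j)) := by
    funext j
    refine Fin.cases ?_ (fun j => ?_) j
    · simp [dface]
    · simp [dface]
      congr 1; omega
  have e3 : ∀ i ∈ Finset.range (m₂ + 1),
      (-1 : ℝ) ^ (i + 1 + 1) * ω₂ (fun j : Fin (m₂ + 1) =>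
        dface (i + 1 + 1) (fun j => if j = 0 then z else x (m₁ + j)) j)
      = (-1 : ℝ) ^ i * ω₂ (Fin.cons (α := fun _ => G) z
          (fun j : Fin m₂ => dface (m₁ + 2 + i) x (m₁ + 1 + j))) := by
    intro i hi
    rw [pow_succ, pow_succ, mul_assoc ((-1 : ℝ) ^ i)]
    norm_num
    congr 1
    funext j
    refine Fin.cases ?_ (fun j => ?_) j
    · simp [dface]
    · simp only [dface, Fin.val_succ, Fin.cons_succ]
      have c1 : ((j : ℕ) + 1 + 1 < i + 1 + 1) ↔ (m₁ + 1 + j + 1 < m₁ + 2 + i) := by omega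
      have c2 : ((j : ℕ) + 1 + 1 = i + 1 + 1) ↔ (m₁ + 1 + j + 1 = m₁ + 2 + i) := by omega
      have c3 : m₁ + ((j : ℕ) + 1) = m₁ + 1 + j := by omega
      have c4 : m₁ + ((j : ℕ) + 1 + 1) = m₁ + 1 + j + 1 := by omega
      simp only [c1, c2, c3, c4]
      simp
  rw [e1, e2, Finset.sum_congr rfl e3] at h
  simp only [Pi.zero_apply] at h
  linear_combination h

lemma S_lin_left {G : Type*} [Group G] (μ k : G → ℝ) (a b : G) (L : List G)
    (s : Finset ℕ) (c : ℕ → ℝ) (f : ℕ → G → ℝ) :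
    ∑ i ∈ s, c i * S μ (f i) k a L b = S μ (fun z => ∑ i ∈ s, c i * f i z) k a L b := by
  unfold S
  simp only [Finset.mul_sum, Finset.sum_mul]
  rw [Finset.sum_comm]
  refine Finset.sum_congr rfl fun _ _ => Finset.sum_congr rfl fun _ _ => by ring

lemma S_lin_right {G : Type*} [Group G] (μ f : G → ℝ) (a b : G) (L : List G)
    (s : Finset ℕ) (c : ℕ → ℝ) (k : ℕ → G → ℝ) :
    ∑ i ∈ s, c i * S μ f (k i) a L b = S μ f (fun z => ∑ i ∈ s, c i * k i z) a L b := by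
  unfold S
  simp only [Finset.mul_sum]
  rw [Finset.sum_comm]
  refine Finset.sum_congr rfl fun _ _ => Finset.sum_congr rfl fun _ _ => by ring

lemma main_eq {m₁ m₂ : ℕ} (D : Decomposition α) (lam : FreeGroup α → ℝ)
    (ω₁ : Cochain (FreeGroup α) (m₁ + 1)) (ω₂ : Cochain (FreeGroup α) (m₂ + 1))
    (hc₁ : cobo ω₁ = 0) (hc₂ : cobo ω₂ = 0)
    (x : ℕ → FreeGroup α) (f k : FreeGroup α → ℝ)
    (hf : f = fun z => ω₁ (Fin.snoc (α := fun _ => FreeGroup α) (fun i : Fin m₁ => x i) z))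
    (hk : k = fun z => ω₂ (Fin.cons (α := fun _ => FreeGroup α) z
      (fun i : Fin m₂ => x (m₁ + 2 + i)))) :
    ω₁ (fun i => x i) * eta2 D lam ω₂ (fun i => x (m₁ + 1 + i))
      + eta1 D lam ω₁ (fun i => x i) * ω₂ (fun i => x (m₁ + 1 + i))
      - (-1 : ℝ) ^ (m₁ + 1) * cobo (etaM D lam ω₁ ω₂) (fun i => x i) =
    S (qm D lam) f k (x m₁) (D.Δ (x (m₁ + 1))) 1
      + S (qm D lam) f k 1 (D.Δ (x m₁)) (x (m₁ + 1))
      - S (qm D lam) f k 1 (D.Δ (x m₁ * x (m₁ + 1))) 1 := by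
  have E2 := eta2_eq D lam ω₂ (fun j => x (m₁ + 1 + j)) (ω₁ (fun i => x i))
  rw [E2, eta1_eq, cobo_eq, show m₁ + m₂ + 1 + 2 = (m₁ + 1) + 1 + (m₂ + 1) by omega,
    Finset.sum_range_add, Finset.sum_range_succ]
  have A1 : ∀ i ∈ Finset.range (m₁ + 1),
      (-1 : ℝ) ^ i * etaM D lam ω₁ ω₂ (fun j => dface i x j) =
      (-1 : ℝ) ^ i * S (qm D lam)
        (fun z => ω₁ (Fin.snoc (α := fun _ => FreeGroup α) (fun j : Fin m₁ => dface i x j) z))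
        k 1 (D.Δ (x (m₁ + 1))) 1 := by
    intro i hi
    have hi := Finset.mem_range.1 hi
    rw [etaM_eq]
    have a1 : dface i x m₁ = x (m₁ + 1) := by
      simp [dface, show ¬ (m₁ + 1 < i) by omega, show ¬ (m₁ + 1 = i) by omega]
    have a2 : ∀ j, dface i x (m₁ + 1 + j) = x (m₁ + 2 + j) := by
      intro j
      simp only [dface, show ¬ (m₁ + 1 + j + 1 < i) by omega,
        show ¬ (m₁ + 1 + j + 1 = i) by omega, if_false]
      congr 1; omega
    simp only [a1, a2, hk]
  have A2 : etaM D lam ω₁ ω₂ (fun j => dface (m₁ + 1) x j) =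
      S (qm D lam) f k 1 (D.Δ (x m₁ * x (m₁ + 1))) 1 := by
    rw [etaM_eq]
    have a1 : dface (m₁ + 1) x m₁ = x m₁ * x (m₁ + 1) := by simp [dface]
    have a2 : ∀ j, dface (m₁ + 1) x (m₁ + 1 + j) = x (m₁ + 2 + j) := by
      intro j
      simp only [dface, show ¬ (m₁ + 1 + j + 1 < m₁ + 1) by omega,
        show ¬ (m₁ + 1 + j + 1 = m₁ + 1) by omega, if_false]
      congr 1; omega
    have a3 : ∀ j : Fin m₁, dface (m₁ + 1) x j = x j := by
      intro j; simp [dface]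
    simp only [a1, a2, a3, hk, hf]
  have A3 : ∀ l ∈ Finset.range (m₂ + 1),
      (-1 : ℝ) ^ (m₁ + 1 + 1 + l) * etaM D lam ω₁ ω₂ (fun j => dface (m₁ + 1 + 1 + l) x j) =
      (-1 : ℝ) ^ m₁ * ((-1 : ℝ) ^ l * S (qm D lam) f
        (fun z => ω₂ (Fin.cons (α := fun _ => FreeGroup α) z
          (fun j : Fin m₂ => dface (m₁ + 2 + l) x (m₁ + 1 + j))))
        1 (D.Δ (x m₁)) 1) := by
    intro l _
    rw [etaM_eq]
    have a1 : dface (m₁ + 1 + 1 + l) x m₁ = x m₁ := by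
      simp only [dface, show m₁ + 1 < m₁ + 1 + 1 + l by omega, if_true]
    have a3 : ∀ j : Fin m₁, dface (m₁ + 1 + 1 + l) x j = x j := by
      intro j
      have := j.isLt
      simp only [dface, show (j : ℕ) + 1 < m₁ + 1 + 1 + l by omega, if_true]
    simp only [a1, a3, hf]
    ring
  rw [Finset.sum_congr rfl A1, A2, Finset.sum_congr rfl A3, ← Finset.mul_sum, S_lin_left,
    S_lin_right]
  simp only [cocycle1 ω₁ hc₁, cocycle2 ω₂ hc₂]
  have hk' : (fun z => ω₂ (Fin.cons (α := fun _ => FreeGroup α) z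
      (fun i : Fin m₂ => x (m₁ + 1 + (i + 1))))) = k := by
    rw [hk]; funext z; congr 2; funext i; congr 1; omega
  rw [hk', ← hf]
  have B1 : S (qm D lam) (fun z => (-1 : ℝ) ^ (m₁ + 1) * (ω₁ (fun i => x i) -
        ω₁ (Fin.snoc (α := fun _ => FreeGroup α) (fun j : Fin m₁ => x j) (x m₁ * z))))
        k 1 (D.Δ (x (m₁ + 1))) 1 =
      (-1 : ℝ) ^ (m₁ + 1) * (S (qm D lam) (fun _ => ω₁ (fun i => x i)) k 1 (D.Δ (x (m₁ + 1))) 1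
        - S (qm D lam) f k (x m₁) (D.Δ (x (m₁ + 1))) 1) := by
    rw [hf]; unfold S
    rw [← Finset.sum_sub_distrib, Finset.mul_sum]
    refine Finset.sum_congr rfl fun _ _ => ?_
    simp only [one_mul]; ring
  have B2 : S (qm D lam) f (fun z =>
       ω₂ (Fin.cons (α := fun _ => FreeGroup α) (z * x (m₁ + 1)) (fun j : Fin m₂ => x (m₁ + 2 + j)))
        - ω₂ (fun i => x (m₁ + 1 + i))) 1 (D.Δ (x m₁)) 1 =
      S (qm D lam) f k 1 (D.Δ (x m₁)) (x (m₁ + 1))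
        - S (qm D lam) f (fun _ => ω₂ (fun i => x (m₁ + 1 + i))) 1 (D.Δ (x m₁)) 1 := by
    rw [hk]; unfold S
    rw [← Finset.sum_sub_distrib]
    refine Finset.sum_congr rfl fun _ _ => ?_
    simp only [mul_one]; ring
  rw [B1, B2]
  have hs : (-1 : ℝ) ^ (m₁ + 1) * (-1 : ℝ) ^ (m₁ + 1) = 1 := by
    rw [← mul_pow]; norm_num
  have hs' : (-1 : ℝ) ^ (m₁ + 1) = - (-1 : ℝ) ^ m₁ := by rw [pow_succ]; ring
  rw [hs'] at hs ⊢
  simp only [add_zero]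
  linear_combination (-(S (qm D lam) (fun _ => ω₁ (fun i => x i)) k 1 (D.Δ (x (m₁ + 1))) 1)
    + S (qm D lam) f k (x m₁) (D.Δ (x (m₁ + 1))) 1
    - S (qm D lam) f k 1 (D.Δ (x m₁ * x (m₁ + 1))) 1
    + S (qm D lam) f k 1 (D.Δ (x m₁)) (x (m₁ + 1))
        - S (qm D lam) f (fun _ => ω₂ (fun i => x (m₁ + 1 + i))) 1 (D.Δ (x m₁)) 1) * hs

lemma Delta_one (D : Decomposition α) : D.Δ 1 = [] := by
  by_contra hne
  obtain ⟨p, hp⟩ := List.exists_mem_of_ne_nil _ hne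
  have h := D.norm_eq 1
  rw [FreeGroup.norm_one] at h
  have h2 := List.sum_eq_zero_iff.1 h.symm (p.norm) (List.mem_map_of_mem hp)
  rw [FreeGroup.norm_eq_zero] at h2
  exact D.one_notMem (h2 ▸ D.piece_mem 1 p hp)

lemma qm_piece (D : Decomposition α) (lam : FreeGroup α → ℝ) (g p : FreeGroup α)
    (hp : p ∈ D.Δ g) : qm D lam p = lam p := by
  obtain ⟨s, t, hst⟩ := List.append_of_mem hp
  have := D.infix_eq g s [p] t (by simp [hst])
  simp at this
  simp [qm, this]

lemma triangle_reduced (D : Decomposition α) (G H : FreeGroup α) (hr : ReducedProd G H) :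
    ∃ a c r₁ r₂ r₃ : FreeGroup α,
      D.Δ G = D.Δ a ++ D.Δ r₁ ∧ D.Δ H = D.Δ r₂ ++ D.Δ c ∧
      D.Δ (G * H) = D.Δ a ++ (D.Δ r₃ ++ D.Δ c) ∧
      (D.Δ r₁).length ≤ D.R ∧ (D.Δ r₂).length ≤ D.R ∧ (D.Δ r₃).length ≤ D.R := by
  obtain ⟨c₁, c₂, c₃, r₁, r₂, r₃, h1, h2, h3, l1, l2, l3⟩ := D.triangle G H
  have n1 : G.norm = (c₁⁻¹).norm + r₁.norm + c₂.norm := by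
    rw [D.norm_eq G, h1]; simp only [List.map_append, List.sum_append, ← D.norm_eq]
  have n2 : H.norm = (c₂⁻¹).norm + r₂.norm + c₃.norm := by
    rw [D.norm_eq H, h2]; simp only [List.map_append, List.sum_append, ← D.norm_eq]
  have p1 : G = c₁⁻¹ * r₁ * c₂ := by
    have := congrArg List.prod h1
    simpa only [List.prod_append, D.prod_eq] using this
  have p2 : H = c₂⁻¹ * r₂ * c₃ := by
    have := congrArg List.prod h2
    simpa only [List.prod_append, D.prod_eq] using this
  have p3 : G * H = (c₁⁻¹ * r₁) * (r₂ * c₃) := by rw [p1, p2]; group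
  have q0 := FreeGroup.norm_mul_le (c₁⁻¹ * r₁) (r₂ * c₃)
  have q1 := FreeGroup.norm_mul_le (c₁⁻¹) r₁
  have q2 := FreeGroup.norm_mul_le r₂ c₃
  unfold ReducedProd at hr
  rw [← p3, hr] at q0
  have hc2 : c₂ = 1 := by
    rw [← FreeGroup.norm_eq_zero]; omega
  subst hc2
  have inv := D.inv_eq ((G * H)⁻¹)
  rw [inv_inv, h3] at inv
  refine ⟨c₁⁻¹, c₃, r₁, r₂, r₃⁻¹, ?_, ?_, ?_, l1, l2, ?_⟩
  · simpa [Delta_one] using h1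
  · simpa [Delta_one] using h2
  · rw [inv, D.inv_eq r₃, D.inv_eq c₁, D.inv_eq c₃]
    simp [List.map_reverse, Function.comp_def]
  · rw [D.inv_eq]; simpa using l3

lemma key_bound (D : Decomposition α) (lam : FreeGroup α → ℝ) (G H : FreeGroup α)
    (hr : ReducedProd G H) (f k : FreeGroup α → ℝ) (A B C : ℝ)
    (hf : ∀ z, |f z| ≤ A) (hk : ∀ z, |k z| ≤ B) (hC0 : 0 ≤ C) (hC : ∀ p ∈ D.P, |lam p| ≤ C) :
    |S (qm D lam) f k G (D.Δ H) 1 + S (qm D lam) f k 1 (D.Δ G) H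
      - S (qm D lam) f k 1 (D.Δ (G * H)) 1| ≤ 3 * (D.R : ℝ) * A * B * C := by
  obtain ⟨a, c, r₁, r₂, r₃, h1, h2, h3, l1, l2, l3⟩ := triangle_reduced D G H hr
  have p1 : G = a * r₁ := by
    have := congrArg List.prod h1
    simpa only [List.prod_append, D.prod_eq] using this
  have p2 : H = r₂ * c := by
    have := congrArg List.prod h2
    simpa only [List.prod_append, D.prod_eq] using this
  have p3 : G * H = a * (r₃ * c) := by
    have := congrArg List.prod h3
    simpa only [List.prod_append, D.prod_eq] using this
  have e1 : r₁ * H = r₃ * c := by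
    have : a * (r₁ * H) = a * (r₃ * c) := by rw [← p3, p1]; group
    exact mul_left_cancel this
  have e2 : G * r₂ = a * r₃ := by
    have : (G * r₂) * c = (a * r₃) * c := by rw [mul_assoc, ← p2, p3]; group
    exact mul_right_cancel this
  rw [h1, h2, h3]
  simp only [S_append, List.prod_append, D.prod_eq, mul_one, one_mul, e1, e2]
  have bd : ∀ r u v, (D.Δ r).length ≤ D.R →
      |S (qm D lam) f k u (D.Δ r) v| ≤ D.R * (A * B * C) := by
    intro r u v hl
    refine S_bound _ _ _ A B C hf hk _ _ _ _ hl ?_ hC0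
    intro p hp
    rw [qm_piece D lam r p hp]
    exact hC p (D.piece_mem r p hp)
  have b1 := abs_le.1 (bd r₁ a H l1)
  have b2 := abs_le.1 (bd r₂ G c l2)
  have b3 := abs_le.1 (bd r₃ a c l3)
  rw [abs_le]
  constructor <;> linarith [b1.1, b1.2, b2.1, b2.2, b3.1, b3.2]

end LeftoverAux

/-- The cochain `ω₁ ∪ η₂ + η₁ ∪ ω₂ − (−1)^{k₁} δη` is bounded on aligned tuples by
`3R · ‖ω₁‖_∞ · ‖ω₂‖_∞ · sup_{p ∈ P} |λ(p)|`. -/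
theorem leftover_cochain_bounded_on_aligned
    (n : ℕ) (hn : 2 ≤ n) (D : Decomposition (Fin n)) (lam : FreeGroup (Fin n) → ℝ)
    (hAlt : IsAlternatingOnPieces D lam) (hBdd : BoundedOnPieces D lam)
    (m₁ m₂ : ℕ)
    (ω₁ : Cochain (FreeGroup (Fin n)) (m₁ + 1)) (ω₂ : Cochain (FreeGroup (Fin n)) (m₂ + 1))
    (hω₁ : IsBoundedCochain ω₁) (hω₂ : IsBoundedCochain ω₂)
    (hc₁ : cobo ω₁ = 0) (hc₂ : cobo ω₂ = 0)
    (g : Fin (m₁ + 1) → FreeGroup (Fin n)) (h : Fin (m₂ + 1) → FreeGroup (Fin n))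
    (hal : Aligned (Fin.append g h)) :
    |cup ω₁ (eta2 D lam ω₂) (Fin.append g h)
        + cup (eta1 D lam ω₁) ω₂ (Fin.append g h)
        - (-1 : ℝ) ^ (m₁ + 1) *
            cobo (etaM D lam ω₁ ω₂)
              (fun i => Fin.append g h
                (Fin.cast (show m₁ + m₂ + 1 + 1 = (m₁ + 1) + (m₂ + 1) by omega) i))| ≤
      3 * (D.R : ℝ) * supNorm ω₁ * supNorm ω₂ * ⨆ p ∈ D.P, |lam p| := by
  classical
  obtain ⟨C₁, hC₁⟩ := hω₁
  obtain ⟨C₂, hC₂⟩ := hω₂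
  obtain ⟨C, hC⟩ := hBdd
  have s1 : ∀ z, |ω₁ z| ≤ supNorm ω₁ := fun z =>
    le_ciSup (f := fun g => |ω₁ g|) ⟨C₁, by rintro _ ⟨y, rfl⟩; exact hC₁ y⟩ z
  have s2 : ∀ z, |ω₂ z| ≤ supNorm ω₂ := fun z =>
    le_ciSup (f := fun g => |ω₂ g|) ⟨C₂, by rintro _ ⟨y, rfl⟩; exact hC₂ y⟩ z
  have s3 : ∀ p ∈ D.P, |lam p| ≤ ⨆ p ∈ D.P, |lam p| := by
    intro p hp
    have hb : BddAbove (Set.range fun p => ⨆ (_ : p ∈ D.P), |lam p|) := by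
      refine ⟨max C 0, ?_⟩
      rintro _ ⟨q, rfl⟩
      by_cases hq : q ∈ D.P
      · simp only [hq, ciSup_unique]
        exact (hC q hq).trans (le_max_left _ _)
      · simp [hq]
    refine le_trans ?_ (le_ciSup hb p)
    simp [hp]
  have s0 : 0 ≤ ⨆ p ∈ D.P, |lam p| :=
    Real.iSup_nonneg fun p => Real.iSup_nonneg fun _ => abs_nonneg _
  set x : ℕ → FreeGroup (Fin n) := fun j =>
    if hj : j < (m₁ + 1) + (m₂ + 1) then Fin.append g h ⟨j, hj⟩ else 1 with hx
  have hxv : ∀ i : Fin ((m₁ + 1) + (m₂ + 1)), Fin.append g h i = x i := by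
    intro i; simp [hx]
  have hg : (fun i => Fin.append g h (Fin.castAdd (m₂ + 1) i)) =
      fun i : Fin (m₁ + 1) => x i := by
    funext i; rw [hxv]; simp
  have hh : (fun i => Fin.append g h (Fin.natAdd (m₁ + 1) i)) =
      fun i : Fin (m₂ + 1) => x (m₁ + 1 + i) := by
    funext i; rw [hxv]; simp
  have hX : (fun i => Fin.append g h
      (Fin.cast (show m₁ + m₂ + 1 + 1 = (m₁ + 1) + (m₂ + 1) by omega) i)) =
      fun i : Fin (m₁ + m₂ + 1 + 1) => x i := by
    funext i; rw [hxv]; simp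
  have hr : ReducedProd (x m₁) (x (m₁ + 1)) := by
    have := hal.2 ⟨m₁, by omega⟩ ⟨m₁ + 1, by omega⟩ rfl
    rwa [hxv, hxv] at this
  unfold cup
  rw [hg, hh, hX, LeftoverAux.main_eq D lam ω₁ ω₂ hc₁ hc₂ x _ _ rfl rfl]
  exact LeftoverAux.key_bound D lam _ _ hr _ _ _ _ _ (fun z => s1 _) (fun z => s2 _) s0 s3
end
end

section
/- Let F be a free group of rank n ≥ 2, let Δ be a decomposition of F with pieces P and constant R, let λ : P → ℝ be a bounded alternating function and φ = φ_{λ,Δ}. Let k₁, k₂ ≥ 1 and let ω₁ : F^{k₁} → ℝ and ω₂ : F^{k₂} → ℝ be bounded cocycles, and let η₁, η₂, η be the associated cochains. Then for every aligned tuple (g₁,…,g_{k₁},h₁,…,h_{k₂}) ∈ B^{k₁+k₂}, the value (ω₁ ∪ η₂ + η₁ ∪ ω₂ − (−1)^{k₁} δη)(g₁,…,g_{k₁},h₁,…,h_{k₂}) equals Σ_{j=1}^{|Δ(g_{k₁})|} ω₁(g₁,…,g_{k₁−1}, z^<_j(g_{k₁}))·φ(g_{k₁}^{(j)})·ω₂(z^>_j(g_{k₁})h₁,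 h₂,…,h_{k₂}) + Σ_{j=1}^{|Δ(h₁)|} ω₁(g₁,…,g_{k₁−1}, g_{k₁}z^<_j(h₁))·φ(h₁^{(j)})·ω₂(z^>_j(h₁), h₂,…,h_{k₂}) − Σ_{j=1}^{|Δ(g_{k₁}h₁)|} ω₁(g₁,…,g_{k₁−1}, z^<_j(g_{k₁}h₁))·φ((g_{k₁}h₁)^{(j)})·ω₂(z^>_j(g_{k₁}h₁), h₂,…,h_{k₂}). -/
open Finset

noncomputable section

variable {α : Type*} [DecidableEq α]

/-- merge entries `i` and `i+1`. -/
def mg {G : Type*} [Group G] {k : ℕ} (g : Fin (k + 1) → G) (i : ℕ) : Fin k → G :=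
  fun j => if (j : ℕ) < i then g (Fin.castSucc j)
              else if (j : ℕ) = i then g (Fin.castSucc j) * g j.succ
              else g j.succ

theorem cobo_range {G : Type*} [Group G] {k : ℕ} (a : Cochain G k) (g : Fin (k + 1) → G) :
    cobo a g = a (Fin.tail g) + ∑ i ∈ range k, (-1 : ℝ) ^ (i + 1) * a (mg g i)
      + (-1 : ℝ) ^ (k + 1) * a (Fin.init g) := by
  rw [← Fin.sum_univ_eq_sum_range (fun i => (-1 : ℝ) ^ (i + 1) * a (mg g i)) k]
  rfl

theorem coc_left {G : Type*} [Group G] {m : ℕ} (w : Cochain G (m + 1)) (hc : cobo w = 0)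
    (g : Fin (m + 1) → G) (z : G) :
    w (Fin.snoc (Fin.tail g) z) + ∑ i ∈ range m, (-1 : ℝ) ^ (i + 1) * w (Fin.snoc (mg g i) z)
      = (-1 : ℝ) ^ m * (w (Function.update g (Fin.last m) (g (Fin.last m) * z)) - w g) := by
  have h0 := congrFun hc (Fin.snoc g z : Fin (m + 2) → G)
  rw [cobo_range, sum_range_succ] at h0
  have e1 : Fin.tail (Fin.snoc g z : Fin (m + 2) → G) = (Fin.snoc (Fin.tail g) z : Fin (m+1) → G) := by
    funext j
    refine Fin.lastCases ?_ (fun j => ?_) j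
    · simp only [Fin.tail, Fin.succ_last, Fin.snoc_last]
    · simp only [Fin.tail, Fin.succ_castSucc, Fin.snoc_castSucc]
  have e2 : ∀ i ∈ range m, (-1 : ℝ) ^ (i + 1) * w (mg (Fin.snoc g z : Fin (m + 2) → G) i)
      = (-1 : ℝ) ^ (i + 1) * w (Fin.snoc (mg g i) z) := by
    intro i hi
    rw [mem_range] at hi
    congr 2
    funext j
    refine Fin.lastCases ?_ (fun j => ?_) j
    · simp only [mg, Fin.succ_last, Fin.snoc_last, Fin.val_last]
      rw [if_neg (by omega), if_neg (by omega)]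
    · simp only [mg, Fin.succ_castSucc, Fin.snoc_castSucc, Fin.val_castSucc]
  have e3 : mg (Fin.snoc g z : Fin (m + 2) → G) m
      = Function.update g (Fin.last m) (g (Fin.last m) * z) := by
    funext j
    refine Fin.lastCases ?_ (fun j => ?_) j
    · simp only [mg, Fin.succ_last, Fin.snoc_last, Fin.val_last, Fin.snoc_castSucc]
      simp
    · simp only [mg, Fin.snoc_castSucc, Fin.val_castSucc]
      rw [if_pos j.isLt, Function.update_of_ne (Fin.castSucc_lt_last j).ne]
  have e4 : Fin.init (Fin.snoc g z : Fin (m + 2) → G) = g := Fin.init_snoc ..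
  rw [e1, sum_congr rfl e2, e3, e4] at h0
  simp only [Pi.zero_apply, pow_succ] at h0 ⊢
  linear_combination h0

theorem coc_right {G : Type*} [Group G] {m : ℕ} (w : Cochain G (m + 1)) (hc : cobo w = 0)
    (h : Fin (m + 1) → G) (z : G) :
    (∑ i ∈ range m, (-1 : ℝ) ^ (i + 1) * w (Fin.cons z (mg h i)))
      + (-1 : ℝ) ^ (m + 1) * w (Fin.cons z (Fin.init h))
      = w h - w (Function.update h 0 (z * h 0)) := by
  have h0 := congrFun hc (Fin.cons z h : Fin (m + 2) → G)
  rw [cobo_range, sum_range_succ'] at h0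
  have e1 : Fin.tail (Fin.cons z h : Fin (m + 2) → G) = h := Fin.tail_cons ..
  have e2 : ∀ i ∈ range m, (-1 : ℝ) ^ (i + 1 + 1) * w (mg (Fin.cons z h : Fin (m + 2) → G) (i + 1))
      = (-1) * ((-1 : ℝ) ^ (i + 1) * w (Fin.cons z (mg h i))) := by
    intro i hi
    have : mg (Fin.cons z h : Fin (m + 2) → G) (i + 1) = (Fin.cons z (mg h i) : Fin (m+1) → G) := by
      funext j
      refine Fin.cases ?_ (fun j => ?_) j
      · simp [mg]
      · simp only [mg, ← Fin.succ_castSucc, Fin.cons_succ, Fin.val_succ, Nat.add_lt_add_iff_right,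
          Nat.add_right_cancel_iff]
    rw [this]; ring
  have e3 : mg (Fin.cons z h : Fin (m + 2) → G) 0 = Function.update h 0 (z * h 0) := by
    funext j
    refine Fin.cases ?_ (fun j => ?_) j
    · simp [mg]
    · simp [mg]
  have e4 : Fin.init (Fin.cons z h : Fin (m + 2) → G) = (Fin.cons z (Fin.init h) : Fin (m+1) → G) := by
    funext j
    refine Fin.cases ?_ (fun j => ?_) j
    · simp [Fin.init]
    · simp only [Fin.init, ← Fin.succ_castSucc, Fin.cons_succ]
  rw [e1, sum_congr rfl e2, e3, e4, ← mul_sum] at h0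
  simp only [Pi.zero_apply, pow_succ] at h0 ⊢
  linear_combination -h0

/-- `etaM` in split form. -/
def etaS {m₁ m₂ : ℕ} (D : Decomposition α) (lam : FreeGroup α → ℝ)
    (ω₁ : Cochain (FreeGroup α) (m₁ + 1)) (ω₂ : Cochain (FreeGroup α) (m₂ + 1))
    (a : Fin m₁ → FreeGroup α) (e : FreeGroup α) (b : Fin m₂ → FreeGroup α) : ℝ :=
  ∑ j ∈ Finset.range (D.Δ e).length,
      ω₁ (Fin.snoc a (zlt D e j)) * qm D lam (piece D e j) * ω₂ (Fin.cons (zgt D e j) b)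

theorem etaM_eq {m₁ m₂ : ℕ} (D : Decomposition α) (lam : FreeGroup α → ℝ)
    (ω₁ : Cochain (FreeGroup α) (m₁ + 1)) (ω₂ : Cochain (FreeGroup α) (m₂ + 1))
    (x : Fin (m₁ + m₂ + 1) → FreeGroup α)
    (a : Fin m₁ → FreeGroup α) (e : FreeGroup α) (b : Fin m₂ → FreeGroup α)
    (ha : ∀ i : Fin m₁, x ⟨i, by omega⟩ = a i) (he : x ⟨m₁, by omega⟩ = e)
    (hb : ∀ i : Fin m₂, x ⟨m₁ + 1 + (i : ℕ), by omega⟩ = b i) :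
    etaM D lam ω₁ ω₂ x = etaS D lam ω₁ ω₂ a e b := by
  obtain rfl : (fun i : Fin m₁ => x ⟨i, by omega⟩) = a := funext ha
  obtain rfl : (fun i : Fin m₂ => x ⟨m₁ + 1 + (i : ℕ), by omega⟩) = b := funext hb
  subst he
  rfl

theorem snoc_init_upd {G : Type*} {m : ℕ} (g : Fin (m + 1) → G) (z : G) :
    (Fin.snoc (Fin.init g) z : Fin (m + 1) → G) = Function.update g (Fin.last m) z := by
  funext j
  refine Fin.lastCases ?_ (fun j => ?_) j
  · simp
  · rw [Fin.snoc_castSucc, Function.update_of_ne (Fin.castSucc_lt_last j).ne]; rfl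

theorem cons_tail_upd {G : Type*} {m : ℕ} (g : Fin (m + 1) → G) (z : G) :
    (Fin.cons z (Fin.tail g) : Fin (m + 1) → G) = Function.update g 0 z := by
  funext j
  refine Fin.cases ?_ (fun j => ?_) j
  · simp
  · simp [Fin.tail]

theorem cobo_etaM {m₁ m₂ : ℕ} (D : Decomposition α) (lam : FreeGroup α → ℝ)
    (ω₁ : Cochain (FreeGroup α) (m₁ + 1)) (ω₂ : Cochain (FreeGroup α) (m₂ + 1))
    (g : Fin (m₁ + 1) → FreeGroup α) (h : Fin (m₂ + 1) → FreeGroup α) :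
    cobo (etaM D lam ω₁ ω₂)
        (fun i => Fin.append g h
          (Fin.cast (show m₁ + m₂ + 1 + 1 = (m₁ + 1) + (m₂ + 1) by omega) i))
      = (etaS D lam ω₁ ω₂ (Fin.tail g) (h 0) (Fin.tail h)
          + ∑ i ∈ range m₁, (-1 : ℝ) ^ (i + 1) * etaS D lam ω₁ ω₂ (mg g i) (h 0) (Fin.tail h))
        + (-1 : ℝ) ^ (m₁ + 1) *
          etaS D lam ω₁ ω₂ (Fin.init g) (g (Fin.last m₁) * h 0) (Fin.tail h)
        + (-1 : ℝ) ^ (m₁ + 1) *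
          (∑ i ∈ range m₂, (-1 : ℝ) ^ (i + 1) *
              etaS D lam ω₁ ω₂ (Fin.init g) (g (Fin.last m₁)) (mg h i)
            + (-1 : ℝ) ^ (m₂ + 1) *
              etaS D lam ω₁ ω₂ (Fin.init g) (g (Fin.last m₁)) (Fin.init h)) := by
  set X : Fin (m₁ + m₂ + 1 + 1) → FreeGroup α := (fun i => Fin.append g h
          (Fin.cast (show m₁ + m₂ + 1 + 1 = (m₁ + 1) + (m₂ + 1) by omega) i)) with hX
  have XL : ∀ (i : ℕ) (hi : i < m₁ + 1) (hi' : i < m₁ + m₂ + 1 + 1), X ⟨i, hi'⟩ = g ⟨i, hi⟩ := by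
    intro i hi hi'
    exact Fin.append_left g h ⟨i, hi⟩
  have XR : ∀ (i l : ℕ) (hi : i < m₂ + 1) (hi' : l < m₁ + m₂ + 1 + 1), l = m₁ + 1 + i →
      X ⟨l, hi'⟩ = h ⟨i, hi⟩ := by
    rintro i _ hi hi' rfl
    exact Fin.append_right g h ⟨i, hi⟩
  have t0 : etaM D lam ω₁ ω₂ (Fin.tail X) = etaS D lam ω₁ ω₂ (Fin.tail g) (h 0) (Fin.tail h) := by
    apply etaM_eq
    · intro i; exact XL _ _ _
    · exact XR 0 _ (by omega) _ (by simp)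
    · intro i; exact XR (i + 1) _ (by omega) _ (by omega)
  have t1 : ∀ i ∈ range m₁, (-1 : ℝ) ^ (i + 1) * etaM D lam ω₁ ω₂ (mg X i) =
      (-1 : ℝ) ^ (i + 1) * etaS D lam ω₁ ω₂ (mg g i) (h 0) (Fin.tail h) := by
    intro i hi
    rw [mem_range] at hi
    congr 1
    apply etaM_eq
    · intro j
      simp only [mg, Fin.castSucc_mk, Fin.succ_mk]
      rw [XL j (by omega), XL (j + 1) (by omega)]
      rfl
    · simp only [mg, Fin.castSucc_mk, Fin.succ_mk]
      rw [if_neg (by omega), if_neg (by omega)]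
      exact XR 0 _ (by omega) _ (by simp)
    · intro j
      simp only [mg, Fin.castSucc_mk, Fin.succ_mk]
      rw [if_neg (by omega), if_neg (by omega)]
      exact XR (j + 1) _ (by omega) _ (by omega)
  have t2 : etaM D lam ω₁ ω₂ (mg X m₁) =
      etaS D lam ω₁ ω₂ (Fin.init g) (g (Fin.last m₁) * h 0) (Fin.tail h) := by
    apply etaM_eq
    · intro j
      simp only [mg, Fin.castSucc_mk, Fin.succ_mk]
      rw [if_pos j.isLt, XL j (by omega)]
      rfl
    · simp only [mg, Fin.castSucc_mk, Fin.succ_mk]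
      rw [if_neg (by omega), if_pos trivial, XL m₁ (by omega), XR 0 (m₁ + 1) (by omega) _ (by simp)]
      rfl
    · intro j
      simp only [mg, Fin.castSucc_mk, Fin.succ_mk]
      rw [if_neg (by omega), if_neg (by omega)]
      exact XR (j + 1) _ (by omega) _ (by omega)
  have t3 : ∀ i ∈ range m₂, (-1 : ℝ) ^ (m₁ + 1 + i + 1) * etaM D lam ω₁ ω₂ (mg X (m₁ + 1 + i)) =
      (-1 : ℝ) ^ (m₁ + 1) * ((-1 : ℝ) ^ (i + 1) *
        etaS D lam ω₁ ω₂ (Fin.init g) (g (Fin.last m₁)) (mg h i)) := by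
    intro i hi
    rw [mem_range] at hi
    rw [← mul_assoc, ← pow_add, add_assoc (m₁ + 1)]
    congr 1
    apply etaM_eq
    · intro j
      simp only [mg, Fin.castSucc_mk, Fin.succ_mk]
      rw [if_pos (by omega), XL j (by omega)]
      rfl
    · simp only [mg, Fin.castSucc_mk, Fin.succ_mk]
      rw [if_pos (by omega), XL m₁ (by omega)]
      rfl
    · intro j
      simp only [mg, Fin.castSucc_mk, Fin.succ_mk]
      rw [XR j _ (by omega) _ rfl, XR (j + 1) _ (by omega) _ (by omega)]
      simp only [Nat.add_lt_add_iff_left, Nat.add_left_cancel_iff]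
      rfl
  have t4 : etaM D lam ω₁ ω₂ (Fin.init X) =
      etaS D lam ω₁ ω₂ (Fin.init g) (g (Fin.last m₁)) (Fin.init h) := by
    apply etaM_eq
    · intro i; exact XL _ _ _
    · exact XL m₁ (by omega) _
    · intro i; exact XR i _ (by omega) _ (by simp)
  rw [cobo_range, t0, t4, show range (m₁ + m₂ + 1) = range (m₁ + 1 + m₂) by congr 1; omega,
    sum_range_add, sum_range_succ, sum_congr rfl t1, t2, sum_congr rfl t3, ← mul_sum]
  ring

theorem final_alg (s E1 E2 S1 S2 S3 : ℝ) (hs : s * s = 1) :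
    E2 + E1 - s * -1 * (s * (S2 - E2) + s * -1 * S3 + s * -1 * (E1 - S1)) = S1 + S2 - S3 := by
  linear_combination (S2 - E2 - S3 - (E1 - S1)) * hs

/-- On aligned tuples, `ω₁ ∪ η₂ + η₁ ∪ ω₂ − (−1)^{k₁} δη` equals the three sums
corresponding to the sides of the geodesic triangle `(1, g_{k₁}, g_{k₁}h₁)`. -/
theorem leftover_cochain_eq_three_sums
    (n : ℕ) (hn : 2 ≤ n) (D : Decomposition (Fin n)) (lam : FreeGroup (Fin n) → ℝ)
    (hAlt : IsAlternatingOnPieces D lam) (hBdd : BoundedOnPieces D lam)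
    (m₁ m₂ : ℕ)
    (ω₁ : Cochain (FreeGroup (Fin n)) (m₁ + 1)) (ω₂ : Cochain (FreeGroup (Fin n)) (m₂ + 1))
    (hω₁ : IsBoundedCochain ω₁) (hω₂ : IsBoundedCochain ω₂)
    (hc₁ : cobo ω₁ = 0) (hc₂ : cobo ω₂ = 0)
    (g : Fin (m₁ + 1) → FreeGroup (Fin n)) (h : Fin (m₂ + 1) → FreeGroup (Fin n))
    (hal : Aligned (Fin.append g h)) :
    cup ω₁ (eta2 D lam ω₂) (Fin.append g h)
        + cup (eta1 D lam ω₁) ω₂ (Fin.append g h)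
        - (-1 : ℝ) ^ (m₁ + 1) *
            cobo (etaM D lam ω₁ ω₂)
              (fun i => Fin.append g h
                (Fin.cast (show m₁ + m₂ + 1 + 1 = (m₁ + 1) + (m₂ + 1) by omega) i))
      = (∑ j ∈ Finset.range (D.Δ (g (Fin.last m₁))).length,
            ω₁ (Function.update g (Fin.last m₁) (zlt D (g (Fin.last m₁)) j)) *
              qm D lam (piece D (g (Fin.last m₁)) j) *
              ω₂ (Function.update h 0 (zgt D (g (Fin.last m₁)) j * h 0)))
        + (∑ j ∈ Finset.range (D.Δ (h 0)).length,
            ω₁ (Function.update g (Fin.last m₁) (g (Fin.last m₁) * zlt D (h 0) j)) *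
              qm D lam (piece D (h 0) j) *
              ω₂ (Function.update h 0 (zgt D (h 0) j)))
        - ∑ j ∈ Finset.range (D.Δ (g (Fin.last m₁) * h 0)).length,
            ω₁ (Function.update g (Fin.last m₁) (zlt D (g (Fin.last m₁) * h 0) j)) *
              qm D lam (piece D (g (Fin.last m₁) * h 0) j) *
              ω₂ (Function.update h 0 (zgt D (g (Fin.last m₁) * h 0) j)) := by
  have c1 : cup ω₁ (eta2 D lam ω₂) (Fin.append g h) = ω₁ g * eta2 D lam ω₂ h := by
    simp only [cup, Fin.append_left, Fin.append_right]
  have c2 : cup (eta1 D lam ω₁) ω₂ (Fin.append g h) = eta1 D lam ω₁ g * ω₂ h := by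
    simp only [cup, Fin.append_left, Fin.append_right]
  have s1 : etaS D lam ω₁ ω₂ (Fin.tail g) (h 0) (Fin.tail h)
          + ∑ i ∈ range m₁, (-1 : ℝ) ^ (i + 1) * etaS D lam ω₁ ω₂ (mg g i) (h 0) (Fin.tail h)
      = (-1 : ℝ) ^ m₁ * ((∑ j ∈ Finset.range (D.Δ (h 0)).length,
            ω₁ (Function.update g (Fin.last m₁) (g (Fin.last m₁) * zlt D (h 0) j)) *
              qm D lam (piece D (h 0) j) *
              ω₂ (Function.update h 0 (zgt D (h 0) j))) - ω₁ g * eta2 D lam ω₂ h) := by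
    simp only [etaS, eta2, mul_sum]
    rw [sum_comm, ← sum_add_distrib, ← sum_sub_distrib, mul_sum]
    refine sum_congr rfl fun j _ => ?_
    have := coc_left ω₁ hc₁ g (zlt D (h 0) j)
    rw [cons_tail_upd]
    have e : ∀ i, (-1 : ℝ) ^ (i + 1) * (ω₁ (Fin.snoc (mg g i) (zlt D (h 0) j)) *
        qm D lam (piece D (h 0) j) * ω₂ (Function.update h 0 (zgt D (h 0) j)))
        = (-1 : ℝ) ^ (i + 1) * ω₁ (Fin.snoc (mg g i) (zlt D (h 0) j)) *
        (qm D lam (piece D (h 0) j) * ω₂ (Function.update h 0 (zgt D (h 0) j))) := by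
      intro i; ring
    simp only [e]
    rw [← sum_mul]
    linear_combination (qm D lam (piece D (h 0) j) * ω₂ (Function.update h 0 (zgt D (h 0) j))) * this
  have s2 : ∑ i ∈ range m₂, (-1 : ℝ) ^ (i + 1) *
              etaS D lam ω₁ ω₂ (Fin.init g) (g (Fin.last m₁)) (mg h i)
            + (-1 : ℝ) ^ (m₂ + 1) *
              etaS D lam ω₁ ω₂ (Fin.init g) (g (Fin.last m₁)) (Fin.init h)
      = eta1 D lam ω₁ g * ω₂ h - ∑ j ∈ Finset.range (D.Δ (g (Fin.last m₁))).length,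
            ω₁ (Function.update g (Fin.last m₁) (zlt D (g (Fin.last m₁)) j)) *
              qm D lam (piece D (g (Fin.last m₁)) j) *
              ω₂ (Function.update h 0 (zgt D (g (Fin.last m₁)) j * h 0)) := by
    simp only [etaS, eta1, mul_sum, sum_mul]
    rw [sum_comm, ← sum_add_distrib, ← sum_sub_distrib]
    refine sum_congr rfl fun j _ => ?_
    have := coc_right ω₂ hc₂ h (zgt D (g (Fin.last m₁)) j)
    rw [snoc_init_upd]
    set A := ω₁ (Function.update g (Fin.last m₁) (zlt D (g (Fin.last m₁)) j)) *
              qm D lam (piece D (g (Fin.last m₁)) j)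
    simp only [mul_left_comm _ A]
    rw [← mul_sum]
    linear_combination A * this
  rw [c1, c2, cobo_etaM, s1, s2]
  simp only [etaS, snoc_init_upd, cons_tail_upd]
  have hs : (-1 : ℝ) ^ m₁ * (-1 : ℝ) ^ m₁ = 1 := by
    rw [← mul_pow]; norm_num
  simp only [pow_succ]
  exact final_alg _ _ _ _ _ _ hs
end
end

section
/- Let F be a free group of rank n ≥ 2 and let Δ be a decomposition of F with pieces P and constant R. If g, h ∈ F are such that the product gh is reduced (|gh| = |g| + |h|), then in property (iv) of the decomposition the middle element c₂ can be taken to be the neutral element: there exist c₁, c₃, r₁, r₂, r₃ ∈ F such that Δ(g) = Δ(c₁^{−1})Δ(r₁), Δ(h) = Δ(r₂)Δ(c₃), Δ((gh)^{−1}) = Δ(c₃^{−1})Δ(r₃)Δ(c₁) (concatenation of sequences), and each Δ(r_i) has length at most R. -/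
open Finset

noncomputable section

variable {α : Type*} [DecidableEq α]

/-- If `gh` is a reduced product, then in property (iv) of a decomposition the middle
element `c₂` can be taken to be the neutral element. -/
theorem triangle_of_reduced
    (n : ℕ) (hn : 2 ≤ n) (D : Decomposition (Fin n))
    (g h : FreeGroup (Fin n)) (hred : ReducedProd g h) :
    ∃ c₁ c₃ r₁ r₂ r₃ : FreeGroup (Fin n),
      D.Δ g = D.Δ (c₁⁻¹) ++ D.Δ r₁ ∧
      D.Δ h = D.Δ r₂ ++ D.Δ c₃ ∧
      D.Δ ((g * h)⁻¹) = D.Δ (c₃⁻¹) ++ D.Δ r₃ ++ D.Δ c₁ ∧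
      (D.Δ r₁).length ≤ D.R ∧ (D.Δ r₂).length ≤ D.R ∧ (D.Δ r₃).length ≤ D.R := by
  obtain ⟨c₁, c₂, c₃, r₁, r₂, r₃, h1, h2, h3, l1, l2, l3⟩ := D.triangle g h
  have key : ∀ x a b c : FreeGroup (Fin n), D.Δ x = D.Δ a ++ D.Δ b ++ D.Δ c →
      x = a * b * c ∧ x.norm = a.norm + b.norm + c.norm := by
    intro x a b c hx
    constructor
    · rw [← D.prod_eq x, hx]
      simp [D.prod_eq, mul_assoc]
    · rw [D.norm_eq x, hx]
      simp only [List.map_append, List.sum_append, ← D.norm_eq]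
  obtain ⟨eg, ng⟩ := key _ _ _ _ h1
  obtain ⟨eh, nh⟩ := key _ _ _ _ h2
  have e : g * h = c₁⁻¹ * r₁ * (r₂ * c₃) := by rw [eg, eh]; group
  have n1 := FreeGroup.norm_mul_le (c₁⁻¹ * r₁) (r₂ * c₃)
  have n2 := FreeGroup.norm_mul_le (c₁⁻¹) r₁
  have n3 := FreeGroup.norm_mul_le r₂ c₃
  unfold ReducedProd at hred
  rw [e] at hred
  have hc : c₂ = 1 := FreeGroup.norm_eq_zero.mp (by omega)
  subst hc
  have hone : D.Δ 1 = [] := by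
    rw [List.eq_nil_iff_forall_not_mem]
    intro p hp
    have hs := D.norm_eq 1
    rw [FreeGroup.norm_one] at hs
    have hle := List.le_sum_of_mem (List.mem_map_of_mem (f := FreeGroup.norm) hp)
    have hp1 : p = 1 := FreeGroup.norm_eq_zero.mp (by omega)
    exact D.one_notMem (hp1 ▸ D.piece_mem 1 p hp)
  refine ⟨c₁, c₃, r₁, r₂, r₃, ?_, ?_, h3, l1, l2, l3⟩
  · simpa [hone] using h1
  · simpa [hone] using h2
end
end

section
/- Let F be a free group of rank n ≥ 2 and let Δ be a decomposition of F with pieces P. Let g, h ∈ F with gh reduced, and suppose c₁, c₃, r₁, r₃ ∈ F satisfy Δ(g) = Δ(c₁^{−1})Δ(r₁) and Δ((gh)^{−1}) = Δ(c₃^{−1})Δ(r₃)Δ(c₁) (concatenation of sequences). Then Δ(gh) = Δ(c₁^{−1})Δ(r₃^{−1})Δ(c₃), and for every 1 ≤ j ≤ m, where m is the length of Δ(c₁^{−1}): the j-th pieces agree, g^{(j)} = (gh)^{(j)}; the partial products agree, z^<_j(g) = z^<_j(gh); and z^>_j(g)·h = z^>_j(gh). -/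
open Finset

noncomputable section

variable {α : Type*} [DecidableEq α]

/-- If `gh` is reduced and `Δ(g) = Δ(c₁⁻¹)Δ(r₁)`, `Δ((gh)⁻¹) = Δ(c₃⁻¹)Δ(r₃)Δ(c₁)`, then
`Δ(gh) = Δ(c₁⁻¹)Δ(r₃⁻¹)Δ(c₃)` and along the first `|Δ(c₁⁻¹)|` pieces the data of `g` and
`gh` agree: `g^{(j)} = (gh)^{(j)}`, `z^<_j(g) = z^<_j(gh)` and `z^>_j(g)·h = z^>_j(gh)`. -/
theorem cancellation_along_c₁
    (n : ℕ) (hn : 2 ≤ n) (D : Decomposition (Fin n))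
    (g h c₁ c₃ r₁ r₃ : FreeGroup (Fin n)) (hred : ReducedProd g h)
    (h₁ : D.Δ g = D.Δ (c₁⁻¹) ++ D.Δ r₁)
    (h₂ : D.Δ ((g * h)⁻¹) = D.Δ (c₃⁻¹) ++ D.Δ r₃ ++ D.Δ c₁) :
    D.Δ (g * h) = D.Δ (c₁⁻¹) ++ D.Δ (r₃⁻¹) ++ D.Δ c₃ ∧
    ∀ j < (D.Δ (c₁⁻¹)).length,
      piece D g j = piece D (g * h) j ∧
      zlt D g j = zlt D (g * h) j ∧
      zgt D g j * h = zgt D (g * h) j := by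
  have key : D.Δ (g * h) = D.Δ (c₁⁻¹) ++ D.Δ (r₃⁻¹) ++ D.Δ c₃ := by
    have e := D.inv_eq ((g * h)⁻¹)
    have e3 := D.inv_eq (c₃⁻¹)
    rw [inv_inv] at e e3
    rw [e, h₂, e3, D.inv_eq c₁, D.inv_eq r₃]
    simp only [List.reverse_append, List.map_append, List.append_assoc]
  refine ⟨key, fun j hj => ?_⟩
  rw [List.append_assoc] at key
  have ht : ∀ i ≤ (D.Δ (c₁⁻¹)).length, (D.Δ g).take i = (D.Δ (g * h)).take i := by
    intro i hi
    rw [h₁, key, List.take_append_of_le_length hi, List.take_append_of_le_length hi]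
  refine ⟨?_, ?_, ?_⟩
  · unfold piece
    rw [h₁, key, List.getD_append _ _ _ _ hj, List.getD_append _ _ _ _ hj]
  · unfold zlt
    rw [ht j hj.le]
  · unfold zgt
    have a := List.prod_take_mul_prod_drop (D.Δ g) (j + 1)
    have b := List.prod_take_mul_prod_drop (D.Δ (g * h)) (j + 1)
    rw [D.prod_eq] at a b
    rw [ht (j + 1) hj] at a
    apply mul_left_cancel (a := ((D.Δ (g * h)).take (j + 1)).prod)
    rw [b, ← mul_assoc, a]
end
end

section
/- Let F be a free group of rank n ≥ 2, let Δ be a decomposition of F with pieces P and constant R, and let λ : P → ℝ be a bounded alternating function. Then φ_{λ,Δ} is a quasi-morphism; explicitly, for all g, h ∈ F, |φ_{λ,Δ}(g) + φ_{λ,Δ}(h) − φ_{λ,Δ}(gh)| ≤ 3R · sup_{p ∈ P} |λ(p)|. -/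
open Finset

noncomputable section

variable {α : Type*} [DecidableEq α]

theorem qm_inv_aux {α : Type*} [DecidableEq α] (D : Decomposition α) (lam : FreeGroup α → ℝ)
    (hAlt : IsAlternatingOnPieces D lam) (g : FreeGroup α) :
    qm D lam g⁻¹ = - qm D lam g := by
  unfold qm
  rw [D.inv_eq, List.map_map, List.map_reverse, List.sum_reverse]
  have key : ∀ l : List (FreeGroup α), (∀ p ∈ l, p ∈ D.P) →
      (l.map (lam ∘ fun p => p⁻¹)).sum = -(l.map lam).sum := by
    intro l
    induction l with
    | nil => intro _; simp
    | cons a t ih =>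
      intro hl
      have h1 := ih (fun p hp => hl p (List.mem_cons_of_mem _ hp))
      have h2 := hAlt a (hl a List.mem_cons_self)
      simp only [List.map_cons, List.sum_cons, Function.comp] at h1 ⊢
      rw [h1, h2]; ring
  exact key _ (D.piece_mem g)

theorem qm_bound_aux {α : Type*} [DecidableEq α] (D : Decomposition α) (lam : FreeGroup α → ℝ)
    (hBdd : BoundedOnPieces D lam) (r : FreeGroup α) (hr : (D.Δ r).length ≤ D.R) :
    |qm D lam r| ≤ (D.R : ℝ) * ⨆ p ∈ D.P, |lam p| := by
  have h0 : (0 : ℝ) ≤ ⨆ p ∈ D.P, |lam p| :=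
    Real.iSup_nonneg fun p => Real.iSup_nonneg fun _ => abs_nonneg _
  have hle : ∀ p ∈ D.P, |lam p| ≤ ⨆ p ∈ D.P, |lam p| := by
    intro p hp
    obtain ⟨C, hC⟩ := hBdd
    have hb : BddAbove (Set.range fun p => ⨆ (_ : p ∈ D.P), |lam p|) := by
      refine ⟨max C 0, ?_⟩
      rintro _ ⟨q, rfl⟩
      exact Real.iSup_le (fun hq => (hC q hq).trans (le_max_left _ _)) (le_max_right _ _)
    have h1 := le_ciSup hb p
    have h2 : (⨆ (_ : p ∈ D.P), |lam p|) = |lam p| := by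
      haveI : Nonempty (p ∈ D.P) := ⟨hp⟩
      exact ciSup_const
    simp only [h2] at h1
    exact h1
  have key : ∀ l : List (FreeGroup α), (∀ p ∈ l, p ∈ D.P) →
      |(l.map lam).sum| ≤ (l.length : ℝ) * ⨆ p ∈ D.P, |lam p| := by
    intro l
    induction l with
    | nil => intro _; simp
    | cons a t ih =>
      intro hl
      have h1 := ih (fun p hp => hl p (List.mem_cons_of_mem _ hp))
      have h2 := hle a (hl a List.mem_cons_self)
      have h3 := abs_add_le (lam a) (t.map lam).sum
      simp only [List.map_cons, List.sum_cons, List.length_cons]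
      push_cast
      linarith
  refine (key _ (D.piece_mem r)).trans ?_
  exact mul_le_mul_of_nonneg_right (by exact_mod_cast hr) h0

/-- `φ_{λ,Δ}` is a quasi-morphism: for all `g, h`,
`|φ(g) + φ(h) − φ(gh)| ≤ 3R · sup_{p ∈ P} |λ(p)|`. -/
theorem qm_is_quasimorphism
    (n : ℕ) (hn : 2 ≤ n) (D : Decomposition (Fin n)) (lam : FreeGroup (Fin n) → ℝ)
    (hAlt : IsAlternatingOnPieces D lam) (hBdd : BoundedOnPieces D lam)
    (g h : FreeGroup (Fin n)) :
    |qm D lam g + qm D lam h - qm D lam (g * h)| ≤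
      3 * (D.R : ℝ) * ⨆ p ∈ D.P, |lam p| := by
  obtain ⟨c₁, c₂, c₃, r₁, r₂, r₃, e1, e2, e3, l1, l2, l3⟩ := D.triangle g h
  have q1 : qm D lam g = qm D lam c₁⁻¹ + qm D lam r₁ + qm D lam c₂ := by
    simp [qm, e1, add_assoc]
  have q2 : qm D lam h = qm D lam c₂⁻¹ + qm D lam r₂ + qm D lam c₃ := by
    simp [qm, e2, add_assoc]
  have q3 : qm D lam (g * h)⁻¹ = qm D lam c₃⁻¹ + qm D lam r₃ + qm D lam c₁ := by
    unfold qm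
    rw [e3]; simp [add_assoc]
  rw [qm_inv_aux D lam hAlt] at q1 q2
  rw [qm_inv_aux D lam hAlt, qm_inv_aux D lam hAlt] at q3
  have b1 := abs_le.1 (qm_bound_aux D lam hBdd r₁ l1)
  have b2 := abs_le.1 (qm_bound_aux D lam hBdd r₂ l2)
  have b3 := abs_le.1 (qm_bound_aux D lam hBdd r₃ l3)
  rw [mul_assoc, abs_le]
  constructor <;> linarith [b1.1, b1.2, b2.1, b2.2, b3.1, b3.2]
end
end

section
/- Let F be a free group of rank n ≥ 2, let Δ be a decomposition of F with pieces P and constant R, let λ : P → ℝ be a bounded alternating function and φ = φ_{λ,Δ}. Let k₂ ≥ 1 and let ω₂ : F^{k₂} → ℝ be a bounded cocycle, with associated cochain η₂. Then the cochain β₂ := φ ∪ ω₂ + δη₂ ∈ C^{k₂+1}(F) satisfies δβ₂ = δφ ∪ ω₂ and is bounded on aligned tuples: there exists C ≥ 0 such that |β₂(h₀, h₁,…,h_{k₂})| ≤ C for all (h₀, h₁,…,h_{k₂}) ∈ B^{k₂+1}. -/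
open Finset

noncomputable section

variable {α : Type*} [DecidableEq α]

section Helpers

theorem cobo_eq {G : Type*} [Group G] {k : ℕ} (a : Cochain G k) (g : Fin (k + 1) → G) :
    cobo a g = a (fun i => g i.succ)
      + ∑ j : Fin (k + 1), (-1 : ℝ) ^ ((j : ℕ) + 1) * a (Fin.contractNth j (· * ·) g) := by
  rw [Fin.sum_univ_castSucc, cobo, add_assoc]
  congr 2
  congr 2
  funext i
  simp [Fin.contractNth]

theorem contract_zero {G : Type*} [Group G] {k : ℕ} (g : Fin (k + 2) → G) :
    Fin.contractNth 0 (· * ·) g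
      = (Fin.cons (g 0 * g 1) (fun i : Fin k => g i.succ.succ) : Fin (k + 1) → G) := by
  funext i
  refine Fin.cases ?_ (fun i => ?_) i <;> simp [Fin.contractNth]

theorem contract_succ {G : Type*} [Group G] {k : ℕ} (j : Fin (k + 1)) (g : Fin (k + 2) → G) :
    Fin.contractNth j.succ (· * ·) g
      = (Fin.cons (g 0) (Fin.contractNth j (· * ·) (fun i => g i.succ)) : Fin (k + 1) → G) := by
  funext i
  refine Fin.cases ?_ (fun i => ?_) i <;> simp [Fin.contractNth]

theorem cobo_succ {G : Type*} [Group G] {k : ℕ} (a : Cochain G (k + 1)) (x y : G)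
    (t : Fin k → G) :
    cobo a (Fin.cons x (Fin.cons y t)) = a (Fin.cons y t) - a (Fin.cons (x * y) t)
      + ∑ j : Fin (k + 1), (-1 : ℝ) ^ (j : ℕ) *
        a (Fin.cons x (Fin.contractNth j (· * ·) (Fin.cons y t : Fin (k + 1) → G))) := by
  rw [cobo_eq, Fin.sum_univ_succ, contract_zero]
  simp only [contract_succ, pow_succ, Fin.val_succ]
  simp
  ring

theorem cobo_cobo {G : Type} [Group G] {k : ℕ} (a : Cochain G k) :
    cobo (cobo a) = 0 := by
  have hd : ∀ (m : ℕ) (b : Cochain G m),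
      (inhomogeneousCochains.d (Rep.trivial ℝ G ℝ) m).hom b = cobo b := by
    intro m b
    funext g
    rw [cobo_eq]
    rfl
  have h := congrArg (fun f => f.hom a)
    (groupCohomology.inhomogeneousCochains.d_comp_d k (Rep.trivial ℝ G ℝ))
  rw [← hd, ← hd]
  exact h

theorem cobo_add {G : Type*} [Group G] {k : ℕ} (a b : Cochain G k) :
    cobo (a + b) = cobo a + cobo b := by
  funext g
  simp only [cobo_eq, Pi.add_apply, mul_add, Finset.sum_add_distrib]
  ring

theorem cup_apply {G : Type*} {k : ℕ} (a : Cochain G 1) (b : Cochain G k)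
    (h : 1 + k = k + 1) (x : G) (t : Fin k → G) :
    copyC h (cup a b) (Fin.cons x t) = a (fun _ => x) * b t := by
  unfold copyC cup
  congr 2
  · funext i
    fin_cases i
    rfl
  · funext i
    have : Fin.cast h (Fin.natAdd 1 i) = i.succ := by ext; simp
    change _ = _
    beta_reduce
    rw [this, Fin.cons_succ]

theorem cup_apply₂ {G : Type*} {k : ℕ} (a : Cochain G 2) (b : Cochain G k)
    (h : 2 + k = k + 1 + 1) (x y : G) (t : Fin k → G) :
    copyC h (cup a b) (Fin.cons x (Fin.cons y t)) = a (Fin.cons x (fun _ => y)) * b t := by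
  unfold copyC cup
  congr 2
  · funext i
    fin_cases i <;> rfl
  · funext i
    have : Fin.cast h (Fin.natAdd 2 i) = i.succ.succ := by ext; simp
    change _ = _
    beta_reduce
    rw [this, Fin.cons_succ, Fin.cons_succ]

theorem cobo_cup {G : Type*} [Group G] {k : ℕ} (a : Cochain G 1) (b : Cochain G (k + 1))
    (hb : cobo b = 0) (h : 1 + (k + 1) = k + 2) (h' : 2 + (k + 1) = k + 2 + 1) :
    cobo (copyC h (cup a b)) = copyC h' (cup (cobo a) b) := by
  funext g
  obtain ⟨x, g, rfl⟩ : ∃ x t, g = Fin.cons x t := ⟨g 0, Fin.tail g, (Fin.cons_self_tail g).symm⟩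
  obtain ⟨y, t, rfl⟩ : ∃ x t, g = Fin.cons x t := ⟨g 0, Fin.tail g, (Fin.cons_self_tail g).symm⟩
  rw [cup_apply₂, cobo_succ]
  simp only [cup_apply]
  have h1 := congrFun hb (Fin.cons y t)
  rw [cobo_eq] at h1
  simp only [Fin.cons_succ, Pi.zero_apply, pow_succ, mul_neg, mul_one, neg_mul,
    Finset.sum_neg_distrib] at h1
  have h2 : cobo a (Fin.cons x fun _ => y)
      = a (fun _ => y) - a (fun _ => x * y) + a (fun _ => x) := by
    have e1 : ∀ u v : Fin 1 → G, u 0 = v 0 → a u = a v := fun u v huv =>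
      congrArg a (funext fun i => by fin_cases i; exact huv)
    have e2 := e1 (fun j => (Fin.cons x (fun _ => y) : Fin 2 → G) j.castSucc * y)
      (fun _ => x * y) rfl
    have e3 := e1 (fun j => (Fin.cons x (fun _ => y) : Fin 2 → G) j.castSucc)
      (fun _ => x) rfl
    simp [cobo]
    rw [e2, e3]
    ring
  rw [h2]
  have h3 : ∑ j : Fin (k + 2), (-1 : ℝ) ^ (j : ℕ) * (a (fun _ => x) *
      b (Fin.contractNth j (· * ·) (Fin.cons y t : Fin (k + 2) → G)))
      = a (fun _ => x) * b t := by
    have : b t = ∑ j : Fin (k + 2), (-1 : ℝ) ^ (j : ℕ) *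
      b (Fin.contractNth j (· * ·) (Fin.cons y t : Fin (k + 2) → G)) := by linarith
    rw [this, Finset.mul_sum]
    exact Finset.sum_congr rfl fun _ _ => by ring
  rw [h3]
  ring

/-- Weighted sum over the pieces of a list. -/
def SS {G : Type*} [Group G] (lam f : G → ℝ) : List G → ℝ
  | [] => 0
  | p :: l => lam p * f l.prod + SS lam f l

theorem SS_append {G : Type*} [Group G] (lam f : G → ℝ) (l₁ l₂ : List G) :
    SS lam f (l₁ ++ l₂) = SS lam (fun x => f (x * l₂.prod)) l₁ + SS lam f l₂ := by
  induction l₁ with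
  | nil => simp [SS]
  | cons p l ih => simp [SS, ih, add_assoc]

theorem SS_bound {G : Type*} [Group G] (lam f : G → ℝ) (P : Set G) (L W : ℝ)
    (hL : ∀ p ∈ P, |lam p| ≤ L) (hL0 : 0 ≤ L) (hW0 : 0 ≤ W) (hW : ∀ x, |f x| ≤ W)
    (l : List G) (hl : ∀ p ∈ l, p ∈ P) (R : ℕ) (hR : l.length ≤ R) :
    |SS lam f l| ≤ R * (L * W) := by
  have key : |SS lam f l| ≤ l.length * (L * W) := by
    clear hR
    induction l with
    | nil => simp [SS]
    | cons p l ih =>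
      have h1 := ih fun q hq => hl q (List.mem_cons_of_mem _ hq)
      have h2 : |lam p * f l.prod| ≤ L * W := by
        rw [abs_mul]
        exact mul_le_mul (hL p (hl p (by simp))) (hW _) (abs_nonneg _) hL0
      simp only [SS, List.length_cons]
      push_cast
      have := abs_add_le (lam p * f l.prod) (SS lam f l)
      linarith
  refine key.trans ?_
  gcongr

theorem SS_lin {G : Type*} [Group G] {ι : Type*} (s : Finset ι) (lam f : G → ℝ) (a : ℝ)
    (c : ι → ℝ) (F : ι → G → ℝ) (h : ∀ x, a + ∑ j ∈ s, c j * F j x = f x) (l : List G) :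
    (l.map lam).sum * a + ∑ j ∈ s, c j * SS lam (F j) l = SS lam f l := by
  induction l with
  | nil => simp [SS]
  | cons p l ih =>
    simp only [SS, List.map_cons, List.sum_cons, ← ih, ← h, mul_add, Finset.sum_add_distrib,
      Finset.mul_sum]
    have : ∑ j ∈ s, c j * (lam p * F j l.prod) = ∑ j ∈ s, lam p * (c j * F j l.prod) :=
      Finset.sum_congr rfl fun _ _ => by ring
    rw [this]
    ring

theorem Delta_piece (D : Decomposition α) (g p : FreeGroup α) (hp : p ∈ D.Δ g) :
    D.Δ p = [p] := by
  obtain ⟨s, t, h⟩ := List.append_of_mem hp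
  have := D.infix_eq g s [p] t (by simp [h])
  simpa using this

theorem Delta_one (D : Decomposition α) : D.Δ 1 = [] := by
  have h := D.norm_eq 1
  rcases hl : D.Δ 1 with _ | ⟨p, l⟩
  · rfl
  · rw [hl] at h
    simp at h
    have : p = 1 := FreeGroup.norm_eq_zero.1 (by omega)
    exact absurd (this ▸ D.piece_mem 1 p (by simp [hl])) D.one_notMem

theorem sum_eq_SS (D : Decomposition α) (lam f : FreeGroup α → ℝ) (l : List (FreeGroup α))
    (hl : ∀ p ∈ l, D.Δ p = [p]) :
    ∑ j ∈ Finset.range l.length, qm D lam (l.getD j 1) * f ((l.drop (j + 1)).prod)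
      = SS lam f l := by
  induction l with
  | nil => simp [SS]
  | cons p l ih =>
    rw [List.length_cons, Finset.sum_range_succ', SS,
      ← ih fun q hq => hl q (List.mem_cons_of_mem _ hq)]
    have : qm D lam p = lam p := by simp [qm, hl p (by simp)]
    simp only [List.getD_cons_zero, List.getD_cons_succ, List.drop_succ_cons, List.drop_zero, this]
    ring

theorem eta2_cons {m : ℕ} (D : Decomposition α) (lam : FreeGroup α → ℝ)
    (ω : Cochain (FreeGroup α) (m + 1)) (x : FreeGroup α) (t : Fin m → FreeGroup α) :
    eta2 D lam ω (Fin.cons x t) = SS lam (fun z => ω (Fin.cons z t)) (D.Δ x) := by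
  rw [← sum_eq_SS D _ _ _ (fun p hp => Delta_piece D x p hp)]
  simp [eta2, piece, zgt]

theorem beta_formula {m : ℕ} (D : Decomposition α) (lam : FreeGroup α → ℝ)
    (ω : Cochain (FreeGroup α) (m + 1)) (hω : cobo ω = 0) (h : 1 + (m + 1) = m + 2)
    (x y : FreeGroup α) (t : Fin m → FreeGroup α) :
    (copyC h (cup (qmC D lam) ω) + cobo (eta2 D lam ω)) (Fin.cons x (Fin.cons y t))
      = SS lam (fun z => ω (Fin.cons z t)) (D.Δ y)
        - SS lam (fun z => ω (Fin.cons z t)) (D.Δ (x * y))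
        + SS lam (fun z => ω (Fin.cons (z * y) t)) (D.Δ x) := by
  rw [Pi.add_apply, cup_apply, cobo_succ]
  simp only [eta2_cons]
  rw [← SS_lin Finset.univ lam (fun z => ω (Fin.cons (z * y) t)) (ω (Fin.cons y t))
    (fun j : Fin (m + 1) => (-1 : ℝ) ^ (j : ℕ))
    (fun j z => ω (Fin.cons z (Fin.contractNth j (· * ·) (Fin.cons y t : Fin (m + 1) → _))))]
  · simp only [qmC, qm]
    ring
  · intro z
    have := congrFun hω (Fin.cons z (Fin.cons y t))
    rw [cobo_succ, Pi.zero_apply] at this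
    linarith

theorem main_bound (D : Decomposition α) (lam f : FreeGroup α → ℝ) (L W : ℝ)
    (hL : ∀ p ∈ D.P, |lam p| ≤ L) (hL0 : 0 ≤ L) (hW0 : 0 ≤ W) (hW : ∀ x, |f x| ≤ W)
    (g h : FreeGroup α) (hr : ReducedProd g h) :
    |SS lam f (D.Δ h) - SS lam f (D.Δ (g * h)) + SS lam (fun z => f (z * h)) (D.Δ g)|
      ≤ 3 * (D.R * (L * W)) := by
  obtain ⟨c₁, c₂, c₃, r₁, r₂, r₃, h1, h2, h3, hr1, hr2, hr3⟩ := D.triangle g h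
  have nrm : ∀ x a b c : FreeGroup α, D.Δ x = D.Δ a ++ D.Δ b ++ D.Δ c →
      x = a * b * c ∧ x.norm = a.norm + b.norm + c.norm := by
    intro x a b c hx
    constructor
    · rw [← D.prod_eq x, hx]
      simp [D.prod_eq, mul_assoc]
    · rw [D.norm_eq x, hx]
      simp [← D.norm_eq, add_assoc]
  obtain ⟨hg, ng⟩ := nrm _ _ _ _ h1
  obtain ⟨hh, nh⟩ := nrm _ _ _ _ h2
  have h4 : D.Δ (g * h) = D.Δ c₁⁻¹ ++ D.Δ r₃⁻¹ ++ D.Δ c₃ := by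
    have : D.Δ (g * h) = D.Δ ((g * h)⁻¹)⁻¹ := by rw [inv_inv]
    rw [this, D.inv_eq, h3, D.inv_eq c₁, D.inv_eq r₃, D.inv_eq c₃]
    simp
  obtain ⟨hgh, -⟩ := nrm _ _ _ _ h4
  have hc2 : c₂ = 1 := by
    have e : g * h = (c₁⁻¹ * r₁) * (r₂ * c₃) := by rw [hg, hh]; group
    have n0 : (g * h).norm = g.norm + h.norm := hr
    have n1 := FreeGroup.norm_mul_le (c₁⁻¹ * r₁) (r₂ * c₃)
    have n2 := FreeGroup.norm_mul_le c₁⁻¹ r₁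
    have n3 := FreeGroup.norm_mul_le r₂ c₃
    rw [← e] at n1
    rw [FreeGroup.norm_inv_eq (x := c₂)] at nh
    exact FreeGroup.norm_eq_zero.1 (by omega)
  subst hc2
  simp only [inv_one, Delta_one, List.append_nil, List.nil_append] at h1 h2
  have key : r₁ * h = r₃⁻¹ * c₃ := by
    have : c₁⁻¹ * (r₁ * h) = c₁⁻¹ * (r₃⁻¹ * c₃) := by
      rw [← mul_assoc c₁⁻¹ r₃⁻¹, ← hgh]
      conv_rhs => rw [hg]
      group
    exact mul_left_cancel this
  rw [h4, h1, List.append_assoc, SS_append, SS_append, SS_append, List.prod_append]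
  simp only [D.prod_eq, mul_assoc, key]
  rw [h2, SS_append, D.prod_eq]
  have b1 := SS_bound lam (fun z => f (z * h)) D.P L W hL hL0 hW0 (fun _ => hW _) (D.Δ r₁)
    (D.piece_mem _) D.R hr1
  have b2 := SS_bound lam (fun z => f (z * c₃)) D.P L W hL hL0 hW0 (fun _ => hW _) (D.Δ r₂)
    (D.piece_mem _) D.R hr2
  have b3 := SS_bound lam (fun z => f (z * c₃)) D.P L W hL hL0 hW0 (fun _ => hW _) (D.Δ r₃⁻¹)
    (D.piece_mem _) D.R (by simpa [D.inv_eq] using hr3)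
  rw [abs_le] at *
  constructor <;> linarith [b1.1, b1.2, b2.1, b2.2, b3.1, b3.2]

end Helpers

/-- The cochain `β₂ := φ ∪ ω₂ + δη₂` satisfies `δβ₂ = δφ ∪ ω₂` and is bounded on
aligned tuples. -/
theorem beta₂_primitive_and_bounded
    (n : ℕ) (hn : 2 ≤ n) (D : Decomposition (Fin n)) (lam : FreeGroup (Fin n) → ℝ)
    (hAlt : IsAlternatingOnPieces D lam) (hBdd : BoundedOnPieces D lam)
    (m₂ : ℕ) (ω₂ : Cochain (FreeGroup (Fin n)) (m₂ + 1))
    (hω₂ : IsBoundedCochain ω₂) (hc₂ : cobo ω₂ = 0) :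
    cobo (copyC (show 1 + (m₂ + 1) = m₂ + 2 by omega) (cup (qmC D lam) ω₂)
          + cobo (eta2 D lam ω₂))
        = copyC (show 2 + (m₂ + 1) = m₂ + 2 + 1 by omega) (cup (cobo (qmC D lam)) ω₂) ∧
      BoundedOnAligned (copyC (show 1 + (m₂ + 1) = m₂ + 2 by omega) (cup (qmC D lam) ω₂)
          + cobo (eta2 D lam ω₂)) := by
  refine ⟨?_, ?_⟩
  · rw [cobo_add, cobo_cobo, add_zero]
    exact cobo_cup _ _ hc₂ _ _
  · obtain ⟨L, hL⟩ := hBdd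
    obtain ⟨W, hW⟩ := hω₂
    have hW0 : 0 ≤ W := (abs_nonneg _).trans (hW fun _ => 1)
    refine ⟨3 * (D.R * (max L 0 * W)), fun g hg => ?_⟩
    have hred := hg.2 0 1 (by simp)
    clear hg
    obtain ⟨x, g, rfl⟩ : ∃ x t, g = Fin.cons x t :=
      ⟨g 0, Fin.tail g, (Fin.cons_self_tail g).symm⟩
    obtain ⟨y, t, rfl⟩ : ∃ x t, g = Fin.cons x t :=
      ⟨g 0, Fin.tail g, (Fin.cons_self_tail g).symm⟩
    rw [beta_formula D lam ω₂ hc₂]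
    exact main_bound D lam (fun z => ω₂ (Fin.cons z t)) (max L 0) W
      (fun p hp => (hL p hp).trans (le_max_left _ _)) (le_max_right _ _) hW0
      (fun _ => hW _) x y hred
end
end
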